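/- arXiv:2011.09365 — 7 statements merged into one kernel-verified Lean document; each statement's English description precedes it below -/
import Mathlib

section
/- (Revenue equivalence) Consider n symmetric bidders with i.i.d. values, and let G with density g be the cdf of the highest value among n − 1 of them. Suppose P: [0,∞) → ℝ is a differentiable expected-payment function with P(0) = 0 such that for every x ≥ 0 the map z ↦ x·G(z) − P(z) attains its maximum at z = x (the equilibrium condition at an increasing symmetric Nash equilibrium of a standard, 0-rational auction). Then for all x ≥ 0, P(x) = ∫₀ˣ s g(s) ds = G(x)·E[Y | Y < x] with Y ∼ G. In particular, the expected payment of a bidder — and hence the seller's revenue and bidders' utilities at such an equilibrium — is independent of the particular standard, 0-rational payment and allocation rules. -/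
open MeasureTheory Set

/-- **Revenue equivalence theorem.**
Let `G` (with density `g`) be the cdf of the highest value among `n - 1` of the symmetric
bidders.  If `P` is a differentiable expected-payment function with `P 0 = 0` (0-rationality)
such that for every `x ≥ 0` the map `z ↦ x * G z - P z` attains its maximum over `[0,∞)`
at `z = x` (the equilibrium condition at an increasing symmetric Nash equilibrium of a
standard auction), then `P x = ∫₀ˣ s g s ds` for all `x ≥ 0`: the expected payment — hence
the seller's revenue and the bidders' utilities — does not depend on the particular
standard, 0-rational auction. -/
theorem revenue_equivalence
    (G g P : ℝ → ℝ)
    (hg_cont : Continuous g) (hg_nonneg : ∀ t, 0 ≤ g t)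
    (hG : ∀ b, HasDerivAt G (g b) b)
    (hP : Differentiable ℝ P) (hP0 : P 0 = 0)
    (heq : ∀ x, 0 ≤ x → IsMaxOn (fun z => x * G z - P z) (Ici 0) x) :
    ∀ x, 0 ≤ x → P x = ∫ s in (0:ℝ)..x, s * g s := by
  intro x hx
  have key : ∀ y ∈ Ioo (0:ℝ) x, HasDerivAt P (y * g y) y := by
    intro y hy
    have hmax : IsLocalMax (fun z => y * G z - P z) y :=
      (heq y hy.1.le).isLocalMax (Ici_mem_nhds hy.1)
    have hd : HasDerivAt (fun z => y * G z - P z) (y * g y - deriv P y) y :=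
      ((hG y).const_mul y).sub (hP y).hasDerivAt
    have h0 := hmax.hasDerivAt_eq_zero hd
    have h1 : y * g y = deriv P y := by linarith
    rw [h1]
    exact (hP y).hasDerivAt
  have hint := intervalIntegral.integral_eq_sub_of_hasDerivAt_of_le hx
    hP.continuous.continuousOn key
    ((continuous_id.mul hg_cont).intervalIntegrable 0 x)
  rw [hP0, sub_zero] at hint
  exact hint.symm
end

section
/- Let X have cdf F with density f on [0,∞) and finite expectation, let Y be independent of X with cdf G and density g (Y represents the highest competing bid), and let r ≥ 0 be a reserve price. Then the expected payment of the bidder at the truthful equilibrium of the lazy second-price auction satisfies E[ max(r, Y)·1{X ≥ Y}·1{X ≥ r} ] = E[ ψ(X)·G(X)·1{X ≥ r} ], where ψ(x) = x − (1 − F(x))/f(x) is the virtual value of F. -/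
open MeasureTheory Set Filter

lemma aux_lsp_ind (r : ℝ) (hr : 0 ≤ r) (h k : ℝ → ℝ)
    (hk : ∀ x, 0 ≤ x → k x = if r ≤ x then h x else 0) :
    ∫ x in Ici (0:ℝ), k x = ∫ x in Ioi r, h x := by
  have h1 : ∫ x in Ici (0:ℝ), k x = ∫ x in Ici (0:ℝ), (Ici r).indicator h x := by
    apply setIntegral_congr_fun measurableSet_Ici
    intro x hx
    simp only [hk x hx, indicator, mem_Ici]
  rw [h1, setIntegral_indicator measurableSet_Ici, ← integral_Ici_eq_integral_Ioi]
  congr 2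
  ext x
  simp only [mem_inter_iff, mem_Ici]
  constructor
  · exact fun h => h.2
  · exact fun h => ⟨hr.trans h, h⟩

/-- **Expected payment in a lazy second-price auction.**
Let `X` have cdf `F` with density `f` on `[0,∞)` and finite expectation, let `Y`
(the highest competing bid) be independent of `X` with cdf `G` and density `g`, and let
`r ≥ 0` be a reserve price.  Then the expected payment of the bidder at the truthful
equilibrium of the lazy second-price auction satisfies
`E[max(r,Y)·1{X ≥ Y}·1{X ≥ r}] = E[ψ(X)·G(X)·1{X ≥ r}]`,
where `ψ x = x - (1 - F x) / f x` is the virtual value of `F`. -/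
theorem lazy_second_price_expected_payment
    (F f G g : ℝ → ℝ)
    (hf_cont : Continuous f) (hf_pos : ∀ x, 0 ≤ x → 0 < f x)
    (hg_cont : Continuous g) (hg_nonneg : ∀ y, 0 ≤ g y)
    (hF : ∀ x, F x = ∫ t in (0:ℝ)..x, f t)
    (hG : ∀ y, G y = ∫ t in (0:ℝ)..y, g t)
    (hFtot : Tendsto F atTop (nhds 1))
    (hGtot : Tendsto G atTop (nhds 1))
    (hexp : IntegrableOn (fun x => x * f x) (Ici 0))
    (r : ℝ) (hr : 0 ≤ r) :
    (∫ x in Ici (0:ℝ), (∫ y in Ici (0:ℝ),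
        max r y * (if y ≤ x then (1:ℝ) else 0) * (if r ≤ x then (1:ℝ) else 0) * f x * g y))
      = ∫ x in Ici (0:ℝ),
          (x - (1 - F x) / f x) * G x * (if r ≤ x then (1:ℝ) else 0) * f x := by
  have dF : ∀ x, HasDerivAt F (f x) x := by
    intro x
    rw [funext hF]
    exact (hf_cont.integral_hasStrictDerivAt 0 x).hasDerivAt
  have dG : ∀ x, HasDerivAt G (g x) x := by
    intro x
    rw [funext hG]
    exact (hg_cont.integral_hasStrictDerivAt 0 x).hasDerivAt
  have cF : Continuous F := continuous_iff_continuousAt.2 fun x => (dF x).continuousAt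
  have cG : Continuous G := continuous_iff_continuousAt.2 fun x => (dG x).continuousAt
  obtain ⟨P, hP⟩ : ∃ P : ℝ → ℝ, ∀ x, P x = ∫ y in (0:ℝ)..x, max r y * g y := ⟨_, fun _ => rfl⟩
  have cm : Continuous (fun y => max r y * g y) := by fun_prop
  have dP : ∀ x, HasDerivAt P (max r x * g x) x := by
    intro x
    rw [funext hP]
    exact (cm.integral_hasStrictDerivAt 0 x).hasDerivAt
  have cP : Continuous P := continuous_iff_continuousAt.2 fun x => (dP x).continuousAt
  have cxf : Continuous (fun y => y * f y) := by fun_prop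
  obtain ⟨M, hM⟩ : ∃ M : ℝ → ℝ, ∀ x, M x = ∫ y in (0:ℝ)..x, y * f y := ⟨_, fun _ => rfl⟩
  have dM : ∀ x, HasDerivAt M (x * f x) x := by
    intro x
    rw [funext hM]
    exact (cxf.integral_hasStrictDerivAt 0 x).hasDerivAt
  have hexp' : IntegrableOn (fun x => x * f x) (Ioi 0) := hexp.mono_set Ioi_subset_Ici_self
  obtain ⟨E, hE⟩ : ∃ E, Tendsto M atTop (nhds E) := by
    refine ⟨∫ y in Ioi (0:ℝ), y * f y, ?_⟩
    rw [funext hM]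
    exact intervalIntegral_tendsto_integral_Ioi 0 hexp' tendsto_id
  -- monotonicity
  have mF : ∀ a b, 0 ≤ a → a ≤ b → a * (F b - F a) ≤ M b - M a := by
    intro a b ha hab
    rw [hF, hF, hM, hM, intervalIntegral.integral_interval_sub_left
      (hf_cont.intervalIntegrable _ _) (hf_cont.intervalIntegrable _ _),
      intervalIntegral.integral_interval_sub_left
      (cxf.intervalIntegrable _ _) (cxf.intervalIntegrable _ _),
      ← intervalIntegral.integral_const_mul]
    apply intervalIntegral.integral_mono_on hab
    · exact (Continuous.intervalIntegrable (by fun_prop) _ _)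
    · exact cxf.intervalIntegrable _ _
    · intro x hx
      exact mul_le_mul_of_nonneg_right hx.1 (hf_pos x (ha.trans hx.1)).le
  have mF' : ∀ a b, 0 ≤ a → a ≤ b → F a ≤ F b := by
    intro a b ha hab
    rw [← sub_nonneg, hF, hF, intervalIntegral.integral_interval_sub_left
      (hf_cont.intervalIntegrable _ _) (hf_cont.intervalIntegrable _ _)]
    exact intervalIntegral.integral_nonneg hab fun x hx => (hf_pos x (ha.trans hx.1)).le
  have mG : Monotone G := by
    intro a b hab
    rw [← sub_nonneg, hG, hG, intervalIntegral.integral_interval_sub_left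
      (hg_cont.intervalIntegrable _ _) (hg_cont.intervalIntegrable _ _)]
    exact intervalIntegral.integral_nonneg hab fun x hx => hg_nonneg x
  have F1 : ∀ x, 0 ≤ x → F x ≤ 1 := by
    intro x hx
    refine ge_of_tendsto hFtot ?_
    filter_upwards [eventually_ge_atTop x] with b hb using mF' x b hx hb
  have G1 : ∀ x, G x ≤ 1 := fun x => mG.ge_of_tendsto hGtot x
  have G0 : ∀ x, 0 ≤ x → 0 ≤ G x := by
    intro x hx
    have := mG hx
    rwa [hG 0, intervalIntegral.integral_same] at this
  have M0 : ∀ x, 0 ≤ x → 0 ≤ M x := by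
    intro x hx
    rw [hM]
    exact intervalIntegral.integral_nonneg hx fun y hy => mul_nonneg hy.1 (hf_pos y hy.1).le
  have tail : ∀ x, 0 ≤ x → x * (1 - F x) ≤ E - M x := by
    intro x hx
    refine le_of_tendsto_of_tendsto ((hFtot.sub_const (F x)).const_mul x) (hE.sub_const (M x)) ?_
    filter_upwards [eventually_ge_atTop x] with b hb using mF x b hx hb
  have tail0 : Tendsto (fun x => x * (1 - F x)) atTop (nhds 0) := by
    have h0 : Tendsto (fun x => E - M x) atTop (nhds 0) := by
      simpa using hE.const_sub E
    refine tendsto_of_tendsto_of_tendsto_of_le_of_le' tendsto_const_nhds h0 ?_ ?_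
    · filter_upwards [eventually_ge_atTop 0] with x hx
      exact mul_nonneg hx (sub_nonneg.2 (F1 x hx))
    · filter_upwards [eventually_ge_atTop 0] with x hx using tail x hx
  have P0 : ∀ x, 0 ≤ x → 0 ≤ P x := by
    intro x hx
    rw [hP]
    exact intervalIntegral.integral_nonneg hx fun y hy =>
      mul_nonneg (hr.trans (le_max_left _ _)) (hg_nonneg y)
  have P1 : ∀ x, r ≤ x → P x ≤ x * G x := by
    intro x hx
    rw [hP, hG, ← intervalIntegral.integral_const_mul]
    apply intervalIntegral.integral_mono_on (hr.trans hx)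
    · exact cm.intervalIntegrable _ _
    · exact (Continuous.intervalIntegrable (by fun_prop) _ _)
    · intro y hy
      exact mul_le_mul_of_nonneg_right (max_le hx hy.2) (hg_nonneg y)
  have Pr : P r = r * G r := by
    rw [hP, hG, ← intervalIntegral.integral_const_mul]
    apply intervalIntegral.integral_congr
    intro y hy
    rw [uIcc_of_le hr] at hy
    simp only [max_eq_left hy.2]
  -- integrability
  have iF : IntegrableOn (fun x => 1 - F x) (Ioi 0) := by
    have dK : ∀ x, HasDerivAt (fun x => x * (1 - F x) + M x) (1 - F x) x := by
      intro x
      have := ((hasDerivAt_id x).mul ((dF x).const_sub 1)).add (dM x)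
      refine this.congr_deriv ?_
      simp only [id]
      ring
    refine integrableOn_Ioi_deriv_of_nonneg' (fun x _ => dK x)
      (fun x hx => sub_nonneg.2 (F1 x (le_of_lt hx))) (tail0.add hE)
  have sub : Ioi r ⊆ Ioi 0 := Ioi_subset_Ioi hr
  have ixf : IntegrableOn (fun x => x * f x) (Ioi r) := hexp'.mono_set sub
  have i1 : IntegrableOn (fun x => f x * P x) (Ioi r) := by
    refine Integrable.mono' ixf (by fun_prop) ?_
    refine (ae_restrict_mem measurableSet_Ioi).mono fun x hx => ?_
    have hx : r < x := hx
    have h0 : 0 ≤ x := hr.trans hx.le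
    have hf := hf_pos x h0
    rw [Real.norm_of_nonneg (mul_nonneg hf.le (P0 x h0)), mul_comm]
    refine mul_le_mul_of_nonneg_right ?_ hf.le
    exact (P1 x hx.le).trans (mul_le_of_le_one_right h0 (G1 x))
  have i2 : IntegrableOn (fun x => (x * f x - (1 - F x)) * G x) (Ioi r) := by
    have hi := (ixf.sub (iF.mono_set sub)).norm
    refine Integrable.mono' hi (by fun_prop) ?_
    refine (ae_restrict_mem measurableSet_Ioi).mono fun x hx => ?_
    have hx : r < x := hx
    have h0 : 0 ≤ x := hr.trans hx.le
    rw [norm_mul, Real.norm_of_nonneg (G0 x h0)]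
    exact mul_le_of_le_one_right (norm_nonneg _) (G1 x)
  have key : ∫ x in Ioi r, (f x * P x - (x * f x - (1 - F x)) * G x) = 0 := by
    have dK : ∀ x ∈ Ici r, HasDerivAt (fun x => -((1 - F x) * (P x - x * G x)))
        (f x * P x - (x * f x - (1 - F x)) * G x) x := by
      intro x hx
      have := (((dF x).const_sub 1).mul ((dP x).sub ((hasDerivAt_id x).mul (dG x)))).neg
      refine this.congr_deriv ?_
      have hx : r ≤ x := hx
      simp only [id, max_eq_right hx, Pi.sub_apply, Pi.mul_apply]
      ring
    have tK : Tendsto (fun x => -((1 - F x) * (P x - x * G x))) atTop (nhds 0) := by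
      refine tendsto_of_tendsto_of_tendsto_of_le_of_le' tendsto_const_nhds tail0 ?_ ?_
      · filter_upwards [eventually_ge_atTop r] with x hx
        have := mul_nonneg (sub_nonneg.2 (F1 x (hr.trans hx))) (sub_nonneg.2 (P1 x hx))
        linarith
      · filter_upwards [eventually_ge_atTop r] with x hx
        have h0 := hr.trans hx
        have h1 := mul_le_of_le_one_right h0 (G1 x)
        have h2 := P0 x h0
        have := mul_nonneg (sub_nonneg.2 (F1 x h0)) (show 0 ≤ x - (x * G x - P x) by linarith)
        linarith
    rw [integral_Ioi_of_hasDerivAt_of_tendsto' dK (i1.sub i2) tK, Pr]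
    ring
  rw [integral_sub i1 i2, sub_eq_zero] at key
  rw [aux_lsp_ind r hr (fun x => f x * P x), key]
  · symm
    apply aux_lsp_ind r hr
    intro x hx
    have := (hf_pos x hx).ne'
    split_ifs
    · field_simp
    · simp
  · intro x hx
    split_ifs with h
    · rw [hP, intervalIntegral.integral_of_le hx, ← integral_Icc_eq_integral_Ioc,
        ← integral_const_mul]
      have h1 : (fun y => max r y * (if y ≤ x then (1:ℝ) else 0) * 1 * f x * g y)
          = (Iic x).indicator (fun y => f x * (max r y * g y)) := by
        ext y
        simp only [indicator, mem_Iic]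
        split_ifs <;> ring
      rw [h1, setIntegral_indicator measurableSet_Iic, Ici_inter_Iic]
    · simp
end

section
/- Let X have cdf F with density f on [0,∞) and finite expectation, and suppose F is regular with continuous increasing virtual value ψ having a root r* (ψ(r*) = 0, ψ < 0 below r*, ψ > 0 above). Let G: [0,∞) → [0,1] be any nondecreasing function (the cdf of the highest competing bid). Then for every r ≥ 0, E[ψ(X)·G(X)·1{X ≥ r*}] ≥ E[ψ(X)·G(X)·1{X ≥ r}]. In particular, in a lazy second-price auction the optimal personalized reserve price of each bidder is his monopoly price ψ⁻¹(0), independently of the presence of the other bidders. -/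
open MeasureTheory Set

/-- **In a lazy second-price auction, the optimal personalized reserve price is the
monopoly price.**  Let `X` have cdf `F` with density `f` on `[0,∞)`, regular with
continuous increasing virtual value `ψ` having root `rstar` (`ψ rstar = 0`, `ψ < 0` below
`rstar` and `ψ > 0` above), and let `G` be any nondecreasing `[0,1]`-valued function (the
cdf of the highest competing bid).  Then for every reserve price `r ≥ 0`,
`E[ψ(X) G(X) 1{X ≥ rstar}] ≥ E[ψ(X) G(X) 1{X ≥ r}]`; so the optimal reserve price of a
bidder is his monopoly price, independently of the presence of the other bidders. -/
theorem lazy_second_price_optimal_reserve_is_monopoly_price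
    (F f G ψ : ℝ → ℝ)
    (hf_nonneg : ∀ x, 0 ≤ f x) (hf_pos : ∀ x, 0 ≤ x → 0 < f x)
    (hF : ∀ x, F x = ∫ t in (0:ℝ)..x, f t)
    (hG_mono : Monotone G) (hG01 : ∀ x, G x ∈ Icc (0:ℝ) 1)
    (hψ : ∀ x, ψ x = x - (1 - F x) / f x)
    (hψ_cont : ContinuousOn ψ (Ici 0))
    (hreg : StrictMonoOn ψ (Ici 0))
    (rstar : ℝ) (hrstar : 0 ≤ rstar) (hroot : ψ rstar = 0)
    (hneg : ∀ x, 0 ≤ x → x < rstar → ψ x < 0)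
    (hpos : ∀ x, rstar < x → 0 < ψ x)
    (hint : IntegrableOn (fun x => ψ x * G x * f x) (Ici 0)) :
    ∀ r, 0 ≤ r →
      (∫ x in Ici (0:ℝ), ψ x * G x * (if r ≤ x then (1:ℝ) else 0) * f x) ≤
        ∫ x in Ici (0:ℝ), ψ x * G x * (if rstar ≤ x then (1:ℝ) else 0) * f x := by
  intro r _
  have key : ∀ a : ℝ, IntegrableOn
      (fun x => ψ x * G x * (if a ≤ x then (1:ℝ) else 0) * f x) (Ici 0) := by
    intro a
    have h : IntegrableOn ((Ici a).indicator (fun x => ψ x * G x * f x)) (Ici 0) :=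
      Integrable.indicator hint measurableSet_Ici
    refine h.congr (Filter.Eventually.of_forall fun x => ?_)
    by_cases hx : a ≤ x <;> simp [indicator, hx]
  refine setIntegral_mono_on (key r) (key rstar) measurableSet_Ici ?_
  intro x hx
  have hx0 : 0 ≤ x := hx
  have hG := (hG01 x).1
  have hf := hf_nonneg x
  by_cases h2 : rstar ≤ x
  · have hp : 0 ≤ ψ x := by
      rcases h2.eq_or_lt with h | h
      · rw [← h, hroot]
      · exact (hpos x h).le
    have : 0 ≤ ψ x * G x * f x := by positivity
    by_cases h1 : r ≤ x <;> simp [h1, h2, this]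
  · have hn : ψ x ≤ 0 := (hneg x hx0 (not_le.mp h2)).le
    have : ψ x * G x * f x ≤ 0 :=
      mul_nonpos_of_nonpos_of_nonneg (mul_nonpos_of_nonpos_of_nonneg hn hG) hf
    by_cases h1 : r ≤ x <;> simp [h1, h2, this]
end

section
/- Let Q: [0,∞) → [0,1] and P: [0,∞) → ℝ with P(0) = 0. The pair (Q, P) is incentive-compatible — i.e. for all x, z ≥ 0, Q(x)·x − P(x) ≥ Q(z)·x − P(z) — if and only if (i) Q is nondecreasing and (ii) P(x) = Q(x)·x − ∫₀ˣ Q(z) dz for all x ≥ 0. -/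
open MeasureTheory Set

theorem ic_integral_bounds (Q : ℝ → ℝ) (hm : MonotoneOn Q (Ici 0)) (a b : ℝ) (ha : 0 ≤ a)
    (hab : a ≤ b) :
    Q a * (b - a) ≤ (∫ z in (0:ℝ)..b, Q z) - (∫ z in (0:ℝ)..a, Q z) ∧
      (∫ z in (0:ℝ)..b, Q z) - (∫ z in (0:ℝ)..a, Q z) ≤ Q b * (b - a) := by
  have hQint : ∀ c d : ℝ, 0 ≤ c → 0 ≤ d → IntervalIntegrable Q volume c d := by
    intro c d hc hd
    apply MonotoneOn.intervalIntegrable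
    apply hm.mono
    intro y hy
    exact le_trans (le_min hc hd) hy.1
  have hb : 0 ≤ b := ha.trans hab
  rw [intervalIntegral.integral_interval_sub_left (hQint 0 b le_rfl hb) (hQint 0 a le_rfl ha)]
  have h1 := intervalIntegral.integral_mono_on (f := fun _ => Q a) (g := Q) (μ := volume) hab
    (by simp) (hQint a b ha hb)
    (fun y hy => hm (mem_Ici.2 ha) (mem_Ici.2 (ha.trans hy.1)) hy.1)
  have h2 := intervalIntegral.integral_mono_on (f := Q) (g := fun _ => Q b) (μ := volume) hab
    (hQint a b ha hb) (by simp)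
    (fun y hy => hm (mem_Ici.2 (ha.trans hy.1)) (mem_Ici.2 hb) hy.2)
  simp only [intervalIntegral.integral_const, smul_eq_mul] at h1 h2
  constructor <;> linarith

theorem ic_const (Q D : ℝ → ℝ)
    (hD : ∀ a b, 0 ≤ a → a ≤ b → |D b - D a| ≤ (Q b - Q a) * (b - a)) (x : ℝ) (hx : 0 ≤ x) :
    D x = D 0 := by
  have key : ∀ (h : ℝ), 0 ≤ h → ∀ n : ℕ, |D (n * h) - D 0| ≤ (Q (n * h) - Q 0) * h := by
    intro h hh n
    induction n with
    | zero => simp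
    | succ k ih =>
      have h1 := hD (k * h) ((k + 1 : ℕ) * h) (by positivity) (by push_cast; nlinarith)
      have h2 : ((k + 1 : ℕ) : ℝ) * h - k * h = h := by push_cast; ring
      rw [h2] at h1
      have h3 := abs_add_le (D ((k + 1 : ℕ) * h) - D (k * h)) (D (k * h) - D 0)
      rw [sub_add_sub_cancel] at h3
      linarith
  have key2 : ∀ n : ℕ, ((n : ℝ) + 1) * |D x - D 0| ≤ (Q x - Q 0) * x := by
    intro n
    have hn : (0:ℝ) < (n : ℝ) + 1 := by positivity
    have h1 := key (x / (n + 1)) (by positivity) (n + 1)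
    have h2 : ((n + 1 : ℕ) : ℝ) * (x / (n + 1)) = x := by push_cast; field_simp
    rw [h2, ← mul_div_assoc, le_div_iff₀ hn] at h1
    linarith
  by_contra hne
  have hpos : 0 < |D x - D 0| := abs_pos.2 (sub_ne_zero.2 hne)
  obtain ⟨n, hn⟩ := exists_nat_gt ((Q x - Q 0) * x / |D x - D 0|)
  rw [div_lt_iff₀ hpos] at hn
  have := key2 n
  nlinarith

/-- **Characterization of incentive-compatible auctions.**
Let `Q : [0,∞) → [0,1]` be an interim allocation rule and `P` an interim payment rule with
`P 0 = 0`.  Then `(Q, P)` is incentive-compatible — `Q x * x - P x ≥ Q z * x - P z` for all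
`x, z ≥ 0` — if and only if (i) `Q` is nondecreasing on `[0,∞)` and (ii)
`P x = Q x * x - ∫₀ˣ Q z dz` for all `x ≥ 0`. -/
theorem incentive_compatible_characterization
    (Q P : ℝ → ℝ)
    (hQ : ∀ x, 0 ≤ x → Q x ∈ Icc (0:ℝ) 1)
    (hP0 : P 0 = 0) :
    (∀ x z, 0 ≤ x → 0 ≤ z → Q z * x - P z ≤ Q x * x - P x) ↔
      (MonotoneOn Q (Ici 0) ∧ ∀ x, 0 ≤ x → P x = Q x * x - ∫ z in (0:ℝ)..x, Q z) := by
  constructor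
  · intro h
    have hm : MonotoneOn Q (Ici 0) := by
      intro a ha b hb hab
      rcases hab.eq_or_lt with rfl | hlt
      · exact le_rfl
      · have h1 := h a b ha hb
        have h2 := h b a hb ha
        by_contra hc
        push Not at hc
        nlinarith [mul_pos (sub_pos.2 hc) (sub_pos.2 hlt)]
    refine ⟨hm, fun x hx => ?_⟩
    have hc := ic_const Q (fun y => Q y * y - P y - ∫ z in (0:ℝ)..y, Q z) (by
      intro a b ha hab
      have h1 := h a b ha (ha.trans hab)
      have h2 := h b a (ha.trans hab) ha
      obtain ⟨h3, h4⟩ := ic_integral_bounds Q hm a b ha hab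
      rw [abs_le]
      constructor <;> nlinarith) x hx
    simp [hP0] at hc
    linarith
  · rintro ⟨hm, hP⟩ x z hx hz
    rw [hP x hx, hP z hz]
    rcases le_total x z with hxz | hxz
    · have := (ic_integral_bounds Q hm x z hx hxz).2
      linarith
    · have := (ic_integral_bounds Q hm z x hz hxz).1
      linarith
end

section
/- (Optimality of the Myerson auction) Let X₁, …, Xₙ be independent values with cdfs F₁, …, Fₙ on [0,∞), each with density fᵢ, finite expectation, and regular (increasing virtual value ψᵢ). Consider any auction given by measurable allocation q: [0,∞)ⁿ → [0,1]ⁿ with Σᵢ qᵢ(x) ≤ 1 and payments pᵢ: [0,∞)ⁿ → ℝ, with interim rules Qᵢ(xᵢ) = E[qᵢ(xᵢ, X₋ᵢ)] and Pᵢ(xᵢ) = E[pᵢ(xᵢ, X₋ᵢ)], that is Bayesian incentive-compatible (Qᵢ(x)x − Pᵢ(x) ≥ Qᵢ(z)x − Pᵢ(z) for all x, z) and interim individually rational (Qᵢ(x)x − Pᵢ(x) ≥ 0 for all x). Then the seller's expected revenue satisfies E[Σᵢ Pᵢ(Xᵢ)] ≤ E[max(0, maxᵢ ψᵢ(Xᵢ))],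 and this bound is attained by the Myerson auction, whose allocation gives the item to the bidder with the highest nonnegative virtual value (keeping it unsold when all virtual values are negative). -/
open MeasureTheory Set

/-- The probability measure of a bidder whose value has density `f` on `[0,∞)`. -/
noncomputable def valueMeasure (f : ℝ → ℝ) : Measure ℝ :=
  (volume.restrict (Ici 0)).withDensity fun x => ENNReal.ofReal (f x)

/-- Interim version (expectation over the other bidders' values) of an ex-post rule `g`:
`interim μ g i xi = E_{X₋ᵢ}[g (xi, X₋ᵢ) i]`. -/
noncomputable def interim {ι : Type*} [Fintype ι] [DecidableEq ι]
    (μ : ι → Measure ℝ) (g : (ι → ℝ) → ι → ℝ) (i : ι) (xi : ℝ) : ℝ :=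
  ∫ y, g (Function.update y i xi) i ∂(Measure.pi μ)


lemma aux_vm_real (f : ℝ → ℝ) (hf_cont : Continuous f) (hf_pos : ∀ x, 0 ≤ x → 0 < f x)
    [IsProbabilityMeasure (valueMeasure f)] (t : ℝ) (ht : 0 ≤ t) :
    valueMeasure f (Ici t) = ENNReal.ofReal (1 - ∫ s in (0:ℝ)..t, f s) := by
  have h1 : valueMeasure f (Iio t) = ENNReal.ofReal (∫ s in (0:ℝ)..t, f s) := by
    rw [valueMeasure, withDensity_apply _ measurableSet_Iio,
      Measure.restrict_restrict measurableSet_Iio, inter_comm, Ici_inter_Iio,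
      intervalIntegral.integral_of_le ht, restrict_Ico_eq_restrict_Ioc]
    rw [ofReal_integral_eq_lintegral_ofReal]
    · exact (hf_cont.integrableOn_Icc).mono_set Ioc_subset_Icc_self
    · filter_upwards [ae_restrict_mem measurableSet_Ioc] with s hs
      exact (hf_pos s hs.1.le).le
  have h0 : 0 ≤ ∫ s in (0:ℝ)..t, f s :=
    intervalIntegral.integral_nonneg ht fun s hs => (hf_pos s hs.1).le
  rw [← compl_Iio, prob_compl_eq_one_sub measurableSet_Iio, h1, ENNReal.ofReal_sub _ h0,
    ENNReal.ofReal_one]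

lemma aux_ae_nonneg (f : ℝ → ℝ) : ∀ᵐ x ∂(valueMeasure f), 0 ≤ x := by
  have h : ∀ᵐ x ∂(volume.restrict (Ici (0:ℝ))), x ∈ Ici (0:ℝ) := ae_restrict_mem measurableSet_Ici
  exact (withDensity_absolutelyContinuous _ _).ae_le h

lemma aux_ii (Q : ℝ → ℝ) (hQm : Measurable Q) (hQ : ∀ x, Q x ∈ Icc (0:ℝ) 1) (a b : ℝ) :
    IntervalIntegrable Q volume a b := by
  rw [intervalIntegrable_iff]
  refine Measure.integrableOn_of_bounded (M := 1) ?_ hQm.aestronglyMeasurable ?_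
  · simp [uIoc]
  · filter_upwards with x
    rw [Real.norm_eq_abs, abs_of_nonneg (hQ x).1]; exact (hQ x).2

lemma aux_key (f : ℝ → ℝ) (hf_cont : Continuous f) (hf_pos : ∀ x, 0 ≤ x → 0 < f x)
    [IsProbabilityMeasure (valueMeasure f)] (hexp : Integrable (fun x => x) (valueMeasure f))
    (Q : ℝ → ℝ) (hQm : Measurable Q) (hQ : ∀ x, Q x ∈ Icc (0:ℝ) 1) :
    Integrable (fun x => Q x * (x - (1 - ∫ s in (0:ℝ)..x, f s) / f x)) (valueMeasure f) ∧
    Integrable (fun x => Q x * x - ∫ s in (0:ℝ)..x, Q s) (valueMeasure f) ∧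
    ∫ x, (Q x * x - ∫ s in (0:ℝ)..x, Q s) ∂(valueMeasure f)
      = ∫ x, Q x * (x - (1 - ∫ s in (0:ℝ)..x, f s) / f x) ∂(valueMeasure f) := by
  set μ := valueMeasure f with hμ
  have hFc : Continuous fun x => ∫ s in (0:ℝ)..x, f s :=
    intervalIntegral.continuous_primitive (fun a b => hf_cont.intervalIntegrable a b) 0
  have hAc : Continuous fun x => ∫ s in (0:ℝ)..x, Q s :=
    intervalIntegral.continuous_primitive (fun a b => aux_ii Q hQm hQ a b) 0
  have hQx : Integrable (fun x => Q x * x) μ := by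
    refine hexp.mono (by fun_prop) ?_
    filter_upwards with x
    rw [norm_mul]
    have : ‖Q x‖ ≤ 1 := by rw [Real.norm_eq_abs, abs_of_nonneg (hQ x).1]; exact (hQ x).2
    nlinarith [norm_nonneg x]
  have hA : Integrable (fun x => ∫ s in (0:ℝ)..x, Q s) μ := by
    refine hexp.mono hAc.aestronglyMeasurable ?_
    filter_upwards with x
    have := intervalIntegral.norm_integral_le_of_norm_le_const (f := Q) (a := 0) (b := x) (C := 1)
      (fun s _ => by rw [Real.norm_eq_abs, abs_of_nonneg (hQ s).1]; exact (hQ s).2)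
    simpa using this
  have hHm : Measurable (fun x => Q x * ((1 - ∫ s in (0:ℝ)..x, f s) / f x)) :=
    hQm.mul ((measurable_const.sub hFc.measurable).div hf_cont.measurable)
  have hF1 : ∀ x, 0 ≤ x → 0 ≤ 1 - ∫ s in (0:ℝ)..x, f s := by
    intro x hx
    by_contra hneg
    push Not at hneg
    have h2 := aux_vm_real f hf_cont hf_pos (x+1) (by linarith)
    have h1 := aux_vm_real f hf_cont hf_pos x hx
    rw [ENNReal.ofReal_of_nonpos hneg.le] at h1
    have h3 : valueMeasure f (Iio x) = 1 := by
      rw [← compl_Ici, prob_compl_eq_one_sub measurableSet_Ici, h1]; simp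
    have h4 : valueMeasure f (Iio x) = ENNReal.ofReal (∫ s in (0:ℝ)..x, f s) := by
      rw [valueMeasure, withDensity_apply _ measurableSet_Iio,
        Measure.restrict_restrict measurableSet_Iio, inter_comm, Ici_inter_Iio,
        intervalIntegral.integral_of_le hx, restrict_Ico_eq_restrict_Ioc]
      rw [ofReal_integral_eq_lintegral_ofReal]
      · exact (hf_cont.integrableOn_Icc).mono_set Ioc_subset_Icc_self
      · filter_upwards [ae_restrict_mem measurableSet_Ioc] with s hs
        exact (hf_pos s hs.1.le).le
    rw [h3] at h4
    have := ENNReal.ofReal_eq_one.1 h4.symm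
    linarith
  have hHnn : ∀ᵐ x ∂μ, 0 ≤ Q x * ((1 - ∫ s in (0:ℝ)..x, f s) / f x) := by
    filter_upwards [aux_ae_nonneg f] with x hx
    exact mul_nonneg (hQ x).1 (div_nonneg (hF1 x hx) (hf_pos x hx).le)
  have hAnn : ∀ᵐ x ∂μ, 0 ≤ ∫ s in (0:ℝ)..x, Q s := by
    filter_upwards [aux_ae_nonneg f] with x hx
    exact intervalIntegral.integral_nonneg hx fun s _ => (hQ s).1
  have hl : ∫⁻ x, ENNReal.ofReal (∫ s in (0:ℝ)..x, Q s) ∂μ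
      = ∫⁻ x, ENNReal.ofReal (Q x * ((1 - ∫ s in (0:ℝ)..x, f s) / f x)) ∂μ := by
    rw [lintegral_comp_eq_lintegral_meas_le_mul μ (f := fun x => x) (aux_ae_nonneg f)
      aemeasurable_id (fun t _ => aux_ii Q hQm hQ 0 t)
      (Filter.Eventually.of_forall fun t => (hQ t).1)]
    rw [hμ, valueMeasure, lintegral_withDensity_eq_lintegral_mul _
      (hf_cont.measurable.ennreal_ofReal) hHm.ennreal_ofReal, restrict_Ioi_eq_restrict_Ici]
    refine setLIntegral_congr_fun measurableSet_Ici fun t ht => ?_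
    have ht' : (0:ℝ) ≤ t := ht
    have e : {a : ℝ | t ≤ a} = Ici t := rfl
    simp only [Pi.mul_apply]
    rw [e, ← valueMeasure, aux_vm_real f hf_cont hf_pos t ht',
      ← ENNReal.ofReal_mul (hF1 t ht'), ← ENNReal.ofReal_mul (hf_pos t ht').le]
    congr 1
    have := (hf_pos t ht').ne'
    field_simp
  have hH : Integrable (fun x => Q x * ((1 - ∫ s in (0:ℝ)..x, f s) / f x)) μ := by
    refine ⟨hHm.aestronglyMeasurable, ?_⟩
    rw [hasFiniteIntegral_iff_ofReal hHnn, ← hl, ← hasFiniteIntegral_iff_ofReal hAnn]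
    exact hA.2
  have e : ∀ x, Q x * (x - (1 - ∫ s in (0:ℝ)..x, f s) / f x)
      = Q x * x - Q x * ((1 - ∫ s in (0:ℝ)..x, f s) / f x) := fun x => by ring
  simp only [e]
  refine ⟨hQx.sub hH, hQx.sub hA, ?_⟩
  rw [integral_sub hQx hA, integral_sub hQx hH, integral_eq_lintegral_of_nonneg_ae hAnn hA.1,
    integral_eq_lintegral_of_nonneg_ae hHnn hH.1, hl]

lemma aux_envelope (Q U : ℝ → ℝ) (hQm : Measurable Q) (hQ : ∀ x, Q x ∈ Icc (0:ℝ) 1)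
    (hU : ∀ x z, 0 ≤ x → 0 ≤ z → U z + Q z * (x - z) ≤ U x) (x : ℝ) (hx : 0 ≤ x) :
    ∫ s in (0:ℝ)..x, Q s ≤ U x - U 0 := by
  have hmono : ∀ a b, 0 ≤ a → a ≤ b → Q a ≤ Q b := by
    intro a b ha hab
    rcases hab.eq_or_lt with rfl | h
    · exact le_rfl
    have h1 := hU a b ha (ha.trans hab)
    have h2 := hU b a (ha.trans hab) ha
    by_contra hc
    push Not at hc
    nlinarith [mul_pos (sub_pos.2 h) (sub_pos.2 hc)]
  have step : ∀ δ : ℝ, 0 ≤ δ → ∀ k : ℕ,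
      (∫ s in (0:ℝ)..(k*δ), Q s) - (U (k*δ) - U 0) ≤ (Q (k*δ) - Q 0) * δ := by
    intro δ hδ k
    induction k with
    | zero => simp
    | succ k ih =>
      have hk : 0 ≤ (k:ℝ)*δ := by positivity
      have hk1 : ((k+1:ℕ):ℝ)*δ = k*δ + δ := by push_cast; ring
      rw [hk1]
      rw [← intervalIntegral.integral_add_adjacent_intervals (aux_ii Q hQm hQ 0 (k*δ))
        (aux_ii Q hQm hQ (k*δ) (k*δ+δ))]
      have h1 : ∫ s in (k*δ)..(k*δ+δ), Q s ≤ Q (k*δ+δ) * δ := by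
        have := intervalIntegral.integral_mono_on (by linarith)
          (aux_ii Q hQm hQ (k*δ) (k*δ+δ)) (intervalIntegrable_const (c := Q (k*δ+δ)))
          (fun s hs => hmono s _ (hk.trans hs.1) hs.2)
        rw [intervalIntegral.integral_const] at this
        simpa [mul_comm] using this
      have h2 := hU (k*δ+δ) (k*δ) (by linarith) hk
      nlinarith
  refine le_of_forall_pos_le_add fun ε hε => ?_
  obtain ⟨n, hn⟩ := exists_nat_gt (x / ε)
  have hn0 : (0:ℝ) < n := lt_of_le_of_lt (by positivity) hn
  have h := step (x / n) (by positivity) n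
  rw [mul_div_cancel₀ _ hn0.ne'] at h
  have h3 : x / n ≤ ε := by
    rw [div_lt_iff₀ hε] at hn
    rw [div_le_iff₀ hn0]; linarith
  have h4 : (Q x - Q 0) * (x/n) ≤ x / n := by
    have : 0 ≤ x / n := by positivity
    nlinarith [(hQ x).2, (hQ 0).1]
  linarith

lemma aux_mp {ι : Type*} [Fintype ι] [DecidableEq ι] (μ : ι → Measure ℝ)
    [∀ i, IsProbabilityMeasure (μ i)] (i : ι) :
    MeasurePreserving (fun z : ℝ × (ι → ℝ) => Function.update z.2 i z.1)
      ((μ i).prod (Measure.pi μ)) (Measure.pi μ) := by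
  have hm : Measurable (fun z : ℝ × (ι → ℝ) => Function.update z.2 i z.1) := by
    rw [measurable_pi_iff]
    intro j
    by_cases h : j = i
    · subst h; simpa using measurable_fst
    · simp only [Function.update_of_ne h]; fun_prop
  refine ⟨hm, ?_⟩
  symm
  refine Measure.pi_eq fun s hs => ?_
  rw [Measure.map_apply hm (MeasurableSet.univ_pi hs)]
  have : (fun z : ℝ × (ι → ℝ) => Function.update z.2 i z.1) ⁻¹' (univ.pi s)
      = (s i) ×ˢ (univ.pi (Function.update s i univ)) := by
    ext z
    simp only [mem_preimage, mem_univ_pi, mem_prod]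
    constructor
    · intro h
      refine ⟨by simpa using h i, fun j => ?_⟩
      by_cases hj : j = i
      · subst hj; simp
      · simpa [Function.update_of_ne hj] using h j
    · rintro ⟨h1, h2⟩ j
      by_cases hj : j = i
      · subst hj; simpa using h1
      · simpa [Function.update_of_ne hj] using h2 j
  rw [this, Measure.prod_prod, Measure.pi_pi, ← Finset.mul_prod_erase _ _ (Finset.mem_univ i),
    ← Finset.mul_prod_erase _ (fun j => μ j (s j)) (Finset.mem_univ i)]
  simp only [Function.update_self, measure_univ, one_mul]
  congr 1
  refine Finset.prod_congr rfl fun j hj => ?_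
  rw [Function.update_of_ne (Finset.ne_of_mem_erase hj)]

lemma aux_update_meas {ι : Type*} [DecidableEq ι] (i : ι) :
    Measurable (fun z : ℝ × (ι → ℝ) => Function.update z.2 i z.1) := by
  rw [measurable_pi_iff]
  intro j
  by_cases h : j = i
  · subst h; simpa using measurable_fst
  · simp only [Function.update_of_ne h]; fun_prop

lemma aux_interim_meas {ι : Type*} [Fintype ι] [DecidableEq ι] (μ : ι → Measure ℝ)
    [∀ i, IsProbabilityMeasure (μ i)] (q : (ι → ℝ) → ι → ℝ) (i : ι)
    (hq : Measurable fun x => q x i) : Measurable (interim μ q i) := by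
  have h := (hq.comp (aux_update_meas i)).stronglyMeasurable.integral_prod_right'
    (ν := Measure.pi μ)
  exact h.measurable

lemma aux_q_int {ι : Type*} [Fintype ι] [DecidableEq ι] (μ : ι → Measure ℝ)
    [∀ i, IsProbabilityMeasure (μ i)] (q : (ι → ℝ) → ι → ℝ) (i : ι)
    (hq : Measurable fun x => q x i) (hq01 : ∀ x i, q x i ∈ Icc (0:ℝ) 1) (x : ℝ) :
    Integrable (fun y => q (Function.update y i x) i) (Measure.pi μ) := by
  refine Integrable.of_bound (C := 1)
    (hq.comp ((aux_update_meas i).comp measurable_prodMk_left)).aestronglyMeasurable ?_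
  filter_upwards with y
  rw [Real.norm_eq_abs, abs_of_nonneg (hq01 _ _).1]; exact (hq01 _ _).2

lemma aux_interim_01 {ι : Type*} [Fintype ι] [DecidableEq ι] (μ : ι → Measure ℝ)
    [∀ i, IsProbabilityMeasure (μ i)] (q : (ι → ℝ) → ι → ℝ) (i : ι)
    (hq : Measurable fun x => q x i) (hq01 : ∀ x i, q x i ∈ Icc (0:ℝ) 1) (x : ℝ) :
    interim μ q i x ∈ Icc (0:ℝ) 1 := by
  refine ⟨integral_nonneg fun y => (hq01 _ _).1, ?_⟩
  have := integral_mono (aux_q_int μ q i hq hq01 x) (integrable_const (1:ℝ))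
    (fun y => (hq01 _ _).2)
  simpa [interim] using this

/-- The virtual surplus identity. -/
lemma aux_surplus {ι : Type*} [Fintype ι] [DecidableEq ι] (μ : ι → Measure ℝ)
    [∀ i, IsProbabilityMeasure (μ i)] (q : (ι → ℝ) → ι → ℝ) (i : ι)
    (hq : Measurable fun x => q x i) (hq01 : ∀ x i, q x i ∈ Icc (0:ℝ) 1)
    (g : ℝ → ℝ) (hg : Integrable g (μ i)) :
    Integrable (fun x => q x i * g (x i)) (Measure.pi μ) ∧
    ∫ x, q x i * g (x i) ∂(Measure.pi μ) = ∫ t, interim μ q i t * g t ∂(μ i) := by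
  have hgi : Integrable (fun x : ι → ℝ => g (x i)) (Measure.pi μ) :=
    (measurePreserving_eval μ i).integrable_comp_of_integrable hg
  have h1 : Integrable (fun x => q x i * g (x i)) (Measure.pi μ) := by
    refine hgi.mono (hq.aestronglyMeasurable.mul hgi.1) ?_
    filter_upwards with x
    rw [norm_mul]
    have : ‖q x i‖ ≤ 1 := by
      rw [Real.norm_eq_abs, abs_of_nonneg (hq01 _ _).1]; exact (hq01 _ _).2
    nlinarith [norm_nonneg (g (x i))]
  refine ⟨h1, ?_⟩
  have mp := aux_mp μ i
  have h2 := mp.integrable_comp_of_integrable h1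
  have h3 : ∫ x, q x i * g (x i) ∂(Measure.pi μ) = ∫ z, q (Function.update z.2 i z.1) i * g z.1
      ∂((μ i).prod (Measure.pi μ)) := by
    conv_lhs => rw [← mp.map_eq]
    rw [integral_map mp.measurable.aemeasurable (by rw [mp.map_eq]; exact h1.1)]
    simp
  rw [h3, integral_prod _ (by simpa [Function.comp_def] using h2)]
  refine integral_congr_ae (Filter.Eventually.of_forall fun t => ?_)
  simp only [interim]
  rw [integral_mul_const]

open Classical in
/-- Indicator that bidder `i` has the highest nonnegative virtual value. -/
noncomputable def topInd {ι : Type*} (ψ : ι → ℝ → ℝ) (x : ι → ℝ) (i : ι) : ℝ :=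
  if 0 ≤ ψ i (x i) ∧ ∀ j, ψ j (x j) ≤ ψ i (x i) then 1 else 0

/-- Myerson allocation with ties split uniformly. -/
noncomputable def myersonQ {ι : Type*} [Fintype ι] (ψ : ι → ℝ → ℝ) (x : ι → ℝ) (i : ι) : ℝ :=
  topInd ψ x i / ∑ k, topInd ψ x k

lemma topInd_nonneg {ι : Type*} (ψ : ι → ℝ → ℝ) (x : ι → ℝ) (i : ι) : 0 ≤ topInd ψ x i := by
  unfold topInd; split_ifs <;> norm_num

lemma myersonQ_meas {ι : Type*} [Fintype ι] (ψ : ι → ℝ → ℝ) (h : ∀ i, Measurable (ψ i)) (i : ι) :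
    Measurable fun x => myersonQ ψ x i := by
  have hb : ∀ i, Measurable fun x => topInd ψ x i := by
    intro i
    refine Measurable.ite ?_ measurable_const measurable_const
    refine MeasurableSet.inter (measurableSet_le measurable_const ((h i).comp (measurable_pi_apply i))) ?_
    have : {x : ι → ℝ | ∀ j, ψ j (x j) ≤ ψ i (x i)} = ⋂ j, {x : ι → ℝ | ψ j (x j) ≤ ψ i (x i)} := by
      ext; simp
    change MeasurableSet {x : ι → ℝ | ∀ j, ψ j (x j) ≤ ψ i (x i)}
    rw [this]
    exact MeasurableSet.iInter fun j =>
      measurableSet_le ((h j).comp (measurable_pi_apply j)) ((h i).comp (measurable_pi_apply i))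
  exact (hb i).div (Finset.measurable_sum _ fun k _ => hb k)

lemma myersonQ_01 {ι : Type*} [Fintype ι] (ψ : ι → ℝ → ℝ) (x : ι → ℝ) (i : ι) :
    myersonQ ψ x i ∈ Icc (0:ℝ) 1 := by
  have h : 0 ≤ ∑ k, topInd ψ x k := Finset.sum_nonneg fun k _ => topInd_nonneg ψ x k
  exact ⟨div_nonneg (topInd_nonneg ψ x i) h, div_le_one_of_le₀
    (Finset.single_le_sum (fun k _ => topInd_nonneg ψ x k) (Finset.mem_univ i)) h⟩

lemma myersonQ_sum_le {ι : Type*} [Fintype ι] (ψ : ι → ℝ → ℝ) (x : ι → ℝ) :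
    ∑ i, myersonQ ψ x i ≤ 1 := by
  unfold myersonQ
  rw [← Finset.sum_div]
  exact div_self_le_one _

lemma myersonQ_ne {ι : Type*} [Fintype ι] (ψ : ι → ℝ → ℝ) (x : ι → ℝ) (i : ι)
    (h : myersonQ ψ x i ≠ 0) : 0 ≤ ψ i (x i) ∧ ∀ j, ψ j (x j) ≤ ψ i (x i) := by
  by_contra hc
  exact h (by simp [myersonQ, topInd, hc])

lemma myersonQ_sum_eq {ι : Type*} [Fintype ι] (ψ : ι → ℝ → ℝ) (x : ι → ℝ)
    (h : ∃ i, 0 ≤ ψ i (x i)) : ∑ i, myersonQ ψ x i = 1 := by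
  obtain ⟨i, hi⟩ := h
  obtain ⟨k, -, hk⟩ := Finset.exists_max_image Finset.univ (fun j => ψ j (x j)) ⟨i, Finset.mem_univ i⟩
  have h1 : topInd ψ x k = 1 := by
    unfold topInd
    rw [if_pos ⟨hi.trans (hk i (Finset.mem_univ i)), fun j => hk j (Finset.mem_univ j)⟩]
  have h2 : topInd ψ x k ≤ ∑ k, topInd ψ x k :=
    Finset.single_le_sum (fun k _ => topInd_nonneg ψ x k) (Finset.mem_univ k)
  unfold myersonQ
  rw [← Finset.sum_div]
  exact div_self (by linarith)

lemma myersonQ_mono {ι : Type*} [Fintype ι] [DecidableEq ι] (ψ : ι → ℝ → ℝ)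
    (hreg : ∀ i, StrictMonoOn (ψ i) (Ici 0)) (y : ι → ℝ) (i : ι) (a b : ℝ) (ha : 0 ≤ a)
    (hab : a ≤ b) :
    myersonQ ψ (Function.update y i a) i ≤ myersonQ ψ (Function.update y i b) i := by
  rcases hab.eq_or_lt with rfl | h
  · exact le_rfl
  by_cases h0 : myersonQ ψ (Function.update y i a) i = 0
  · rw [h0]; exact (myersonQ_01 _ _ _).1
  obtain ⟨h1, h2⟩ := myersonQ_ne ψ _ i h0
  have h3 := hreg i ha (ha.trans hab) h
  have hz : ∀ j, j ≠ i → myersonQ ψ (Function.update y i b) j = 0 := by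
    intro j hj
    by_contra hc
    have h4 := (myersonQ_ne ψ _ j hc).2 i
    have h5 := h2 j
    simp only [Function.update_self, Function.update_of_ne hj] at h4 h5
    linarith
  have h6 := myersonQ_sum_eq ψ (Function.update y i b) ⟨i, by simp at h1 ⊢; linarith⟩
  rw [Finset.sum_eq_single i (fun j _ hj => hz j hj) (by simp)] at h6
  rw [h6]; exact (myersonQ_01 _ _ _).2

lemma myersonQ_surplus {ι : Type*} [Fintype ι] [Nonempty ι] (ψ : ι → ℝ → ℝ) (x : ι → ℝ) :
    ∑ i, myersonQ ψ x i * ψ i (x i)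
      = max 0 (Finset.univ.sup' Finset.univ_nonempty fun i => ψ i (x i)) := by
  set M := Finset.univ.sup' Finset.univ_nonempty fun i => ψ i (x i) with hM
  have hle : ∀ i, ψ i (x i) ≤ M := fun i =>
    Finset.le_sup' (fun i => ψ i (x i)) (Finset.mem_univ i)
  have e : ∀ i, myersonQ ψ x i * ψ i (x i) = myersonQ ψ x i * M := by
    intro i
    by_cases h0 : myersonQ ψ x i = 0
    · simp [h0]
    congr 1
    exact le_antisymm (hle i) (Finset.sup'_le _ _ fun j _ => (myersonQ_ne ψ x i h0).2 j)
  simp only [e]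
  rw [← Finset.sum_mul]
  by_cases h : ∃ i, 0 ≤ ψ i (x i)
  · rw [myersonQ_sum_eq ψ x h, one_mul]
    obtain ⟨i, hi⟩ := h
    rw [max_eq_right (hi.trans (hle i))]
  · have hz : ∀ i, myersonQ ψ x i = 0 := by
      intro i
      by_contra hc
      exact h ⟨i, (myersonQ_ne ψ x i hc).1⟩
    push Not at h
    have : M ≤ 0 := Finset.sup'_le _ _ fun j _ => (h j).le
    simp [hz, this]

lemma surplus_le {ι : Type*} [Fintype ι] [Nonempty ι] (ψ : ι → ℝ → ℝ) (x : ι → ℝ) (w : ι → ℝ)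
    (hw : ∀ i, 0 ≤ w i) (hs : ∑ i, w i ≤ 1) :
    ∑ i, w i * ψ i (x i)
      ≤ max 0 (Finset.univ.sup' Finset.univ_nonempty fun i => ψ i (x i)) := by
  set M := Finset.univ.sup' Finset.univ_nonempty fun i => ψ i (x i) with hM
  have hle : ∀ i, ψ i (x i) ≤ max 0 M := fun i =>
    (Finset.le_sup' (fun i => ψ i (x i)) (Finset.mem_univ i)).trans (le_max_right _ _)
  calc ∑ i, w i * ψ i (x i) ≤ ∑ i, w i * max 0 M :=
        Finset.sum_le_sum fun i _ => mul_le_mul_of_nonneg_left (hle i) (hw i)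
    _ = (∑ i, w i) * max 0 M := by rw [Finset.sum_mul]
    _ ≤ max 0 M := by nlinarith [le_max_left 0 M]

/-- **Optimality of the Myerson auction.**
For independent regular bidders, every Bayesian incentive-compatible and interim
individually rational auction `(q, p)` has expected revenue at most
`E[max(0, maxᵢ ψᵢ(Xᵢ))]`, and this bound is attained by the Myerson auction, whose
allocation gives the item to the bidder with the highest nonnegative virtual value
(keeping it unsold when all virtual values are negative). -/
theorem myerson_auction_optimal
    {ι : Type*} [Fintype ι] [DecidableEq ι] [Nonempty ι]
    (F f ψ : ι → ℝ → ℝ)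
    (hf_cont : ∀ i, Continuous (f i))
    (hf_pos : ∀ i x, 0 ≤ x → 0 < f i x)
    (hF : ∀ i x, F i x = ∫ t in (0:ℝ)..x, f i t)
    (hψ : ∀ i x, ψ i x = x - (1 - F i x) / f i x)
    (hreg : ∀ i, StrictMonoOn (ψ i) (Ici 0))
    (μ : ι → Measure ℝ) (hμ : ∀ i, μ i = valueMeasure (f i))
    (hprob : ∀ i, IsProbabilityMeasure (μ i))
    (hexp : ∀ i, Integrable (fun x => x) (μ i))
    (q p : (ι → ℝ) → ι → ℝ)
    (hq_meas : ∀ i, Measurable fun x => q x i)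
    (hp_meas : ∀ i, Measurable fun x => p x i)
    (hq01 : ∀ x i, q x i ∈ Icc (0:ℝ) 1)
    (hq_sum : ∀ x, (∑ i, q x i) ≤ 1)
    (hp_int : ∀ i xi, Integrable (fun y => p (Function.update y i xi) i) (Measure.pi μ))
    (hBIC : ∀ i x z, 0 ≤ x → 0 ≤ z →
      interim μ q i z * x - interim μ p i z ≤ interim μ q i x * x - interim μ p i x)
    (hIR : ∀ i x, 0 ≤ x → 0 ≤ interim μ q i x * x - interim μ p i x) :
    (∫ x, (∑ i, interim μ p i (x i)) ∂Measure.pi μ)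
        ≤ (∫ x, max 0 (Finset.univ.sup' Finset.univ_nonempty fun i => ψ i (x i))
            ∂Measure.pi μ) ∧
      ∃ q' p' : (ι → ℝ) → ι → ℝ,
        (∀ i, Measurable fun x => q' x i) ∧
        (∀ i, Measurable fun x => p' x i) ∧
        (∀ x i, q' x i ∈ Icc (0:ℝ) 1) ∧
        (∀ x, (∑ i, q' x i) ≤ 1) ∧
        (∀ x i, q' x i ≠ 0 → 0 ≤ ψ i (x i) ∧ ∀ j, ψ j (x j) ≤ ψ i (x i)) ∧
        (∀ x, (∃ i, 0 ≤ ψ i (x i)) → (∑ i, q' x i) = 1) ∧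
        (∀ i xi, Integrable (fun y => p' (Function.update y i xi) i) (Measure.pi μ)) ∧
        (∀ i x z, 0 ≤ x → 0 ≤ z →
          interim μ q' i z * x - interim μ p' i z
            ≤ interim μ q' i x * x - interim μ p' i x) ∧
        (∀ i x, 0 ≤ x → 0 ≤ interim μ q' i x * x - interim μ p' i x) ∧
        (∫ x, (∑ i, interim μ p' i (x i)) ∂Measure.pi μ)
          = (∫ x, max 0 (Finset.univ.sup' Finset.univ_nonempty fun i => ψ i (x i))
              ∂Measure.pi μ) := by
  have := hprob
  have hFc : ∀ i, Continuous (F i) := fun i => by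
    have : F i = fun x => ∫ s in (0:ℝ)..x, f i s := funext (hF i)
    rw [this]
    exact intervalIntegral.continuous_primitive (fun a b => (hf_cont i).intervalIntegrable a b) 0
  have hψm : ∀ i, Measurable (ψ i) := fun i => by
    have : ψ i = fun x => x - (1 - F i x) / f i x := funext (hψ i)
    rw [this]
    exact measurable_id.sub ((measurable_const.sub (hFc i).measurable).div (hf_cont i).measurable)
  have hae : ∀ᵐ x ∂(Measure.pi μ), ∀ i, 0 ≤ x i := by
    rw [Filter.eventually_all]
    intro i
    have h : ∀ᵐ t ∂(μ i), 0 ≤ t := by rw [hμ i]; exact aux_ae_nonneg (f i)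
    exact (measurePreserving_eval μ i).quasiMeasurePreserving.ae h
  have key : ∀ i (Q : ℝ → ℝ), Measurable Q → (∀ x, Q x ∈ Icc (0:ℝ) 1) →
      Integrable (fun x => Q x * ψ i x) (μ i) ∧
      Integrable (fun x => Q x * x - ∫ s in (0:ℝ)..x, Q s) (μ i) ∧
      ∫ x, (Q x * x - ∫ s in (0:ℝ)..x, Q s) ∂(μ i) = ∫ x, Q x * ψ i x ∂(μ i) := by
    intro i Q hQm hQ
    have : IsProbabilityMeasure (valueMeasure (f i)) := hμ i ▸ hprob i
    have h := aux_key (f i) (hf_cont i) (hf_pos i) (hμ i ▸ hexp i) Q hQm hQ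
    simp only [hψ, hF]
    rw [hμ i]
    exact h
  have hψi : ∀ i, Integrable (ψ i) (μ i) := fun i => by
    simpa using (key i (fun _ => 1) measurable_const (fun _ => by simp)).1

  have rev : ∀ r : (ι → ℝ) → ι → ℝ, (∀ i, Measurable fun x => r x i) →
      (∀ x i, r x i ∈ Icc (0:ℝ) 1) →
      Integrable (fun x : ι → ℝ => ∑ i, (interim μ r i (x i) * x i
        - ∫ s in (0:ℝ)..(x i), interim μ r i s)) (Measure.pi μ) ∧
      Integrable (fun x : ι → ℝ => ∑ i, r x i * ψ i (x i)) (Measure.pi μ) ∧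
      ∫ x : ι → ℝ, (∑ i, (interim μ r i (x i) * x i
        - ∫ s in (0:ℝ)..(x i), interim μ r i s)) ∂(Measure.pi μ)
      = ∫ x, ∑ i, r x i * ψ i (x i) ∂(Measure.pi μ) := by
    intro r hr hr01
    have hk := fun i => key i (interim μ r i) (aux_interim_meas μ r i (hr i))
      (aux_interim_01 μ r i (hr i) hr01)
    have hs := fun i => aux_surplus μ r i (hr i) hr01 (ψ i) (hψi i)
    have h1 : ∀ i, Integrable (fun x : ι → ℝ => interim μ r i (x i) * x i
        - ∫ s in (0:ℝ)..(x i), interim μ r i s) (Measure.pi μ) := fun i =>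
      (measurePreserving_eval μ i).integrable_comp_of_integrable (hk i).2.1
    refine ⟨integrable_finsetSum _ fun i _ => h1 i, integrable_finsetSum _ fun i _ => (hs i).1, ?_⟩
    rw [integral_finsetSum _ fun i _ => h1 i, integral_finsetSum _ fun i _ => (hs i).1]
    refine Finset.sum_congr rfl fun i _ => ?_
    rw [(hs i).2, ← (hk i).2.2, ← (measurePreserving_eval μ i).map_eq,
      integral_map (measurable_pi_apply i).aemeasurable]
    rw [(measurePreserving_eval μ i).map_eq]
    exact (hk i).2.1.1
  have hMm := myersonQ_meas ψ hψm
  have hMb := myersonQ_01 ψ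
  have revM := rev (myersonQ ψ) hMm hMb
  simp only [myersonQ_surplus] at revM
  constructor
  · by_cases hint : Integrable (fun x : ι → ℝ => ∑ i, interim μ p i (x i)) (Measure.pi μ)
    · obtain ⟨r1, r2, r3⟩ := rev q hq_meas hq01
      calc _ ≤ _ := integral_mono_ae hint r1 ?_
        _ = _ := r3
        _ ≤ _ := integral_mono r2 revM.2.1 fun x => surplus_le ψ x (q x)
                  (fun i => (hq01 x i).1) (hq_sum x)
      filter_upwards [hae] with x hx
      refine Finset.sum_le_sum fun i _ => ?_
      have h := aux_envelope (interim μ q i) (fun t => interim μ q i t * t - interim μ p i t)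
        (aux_interim_meas μ q i (hq_meas i)) (aux_interim_01 μ q i (hq_meas i) hq01)
        (fun a b ha hb => by have := hBIC i a b ha hb; linarith) (x i) (hx i)
      have h0 := hIR i 0 le_rfl
      linarith
    · rw [integral_undef hint]
      exact integral_nonneg fun x => le_max_left _ _
  · have hm : ∀ i, Measurable (interim μ (myersonQ ψ) i) :=
      fun i => aux_interim_meas μ _ i (hMm i)
    have h01 : ∀ i x, interim μ (myersonQ ψ) i x ∈ Icc (0:ℝ) 1 :=
      fun i => aux_interim_01 μ _ i (hMm i) hMb
    have hii := fun i => aux_ii (interim μ (myersonQ ψ) i) (hm i) (h01 i)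
    have hmono : ∀ i a b, 0 ≤ a → a ≤ b →
        interim μ (myersonQ ψ) i a ≤ interim μ (myersonQ ψ) i b := fun i a b ha hab =>
      integral_mono (aux_q_int μ _ i (hMm i) hMb a) (aux_q_int μ _ i (hMm i) hMb b)
        fun y => myersonQ_mono ψ hreg y i a b ha hab
    let P : (ι → ℝ) → ι → ℝ := fun x i => interim μ (myersonQ ψ) i (x i) * x i
        - ∫ s in (0:ℝ)..(x i), interim μ (myersonQ ψ) i s
    have hP : ∀ i t, interim μ P i t = interim μ (myersonQ ψ) i t * t
        - ∫ s in (0:ℝ)..t, interim μ (myersonQ ψ) i s := by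
      intro i t
      conv_lhs => unfold interim
      simp [P]
    refine ⟨myersonQ ψ, P, hMm, ?_, hMb, myersonQ_sum_le ψ, myersonQ_ne ψ, myersonQ_sum_eq ψ,
      ?_, ?_, ?_, ?_⟩
    · intro i
      have hc : Continuous fun t => ∫ s in (0:ℝ)..t, interim μ (myersonQ ψ) i s :=
        intervalIntegral.continuous_primitive (hii i) 0
      exact (((hm i).comp (measurable_pi_apply i)).mul (measurable_pi_apply i)).sub
        (hc.measurable.comp (measurable_pi_apply i))
    · intro i xi
      simp only [P, Function.update_self]
      exact integrable_const _
    · intro i x z hx hz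
      rw [hP, hP]
      have e := intervalIntegral.integral_add_adjacent_intervals (hii i 0 z) (hii i z x)
      have h : interim μ (myersonQ ψ) i z * (x - z)
          ≤ ∫ s in z..x, interim μ (myersonQ ψ) i s := by
        rcases le_total z x with hzx | hzx
        · have := intervalIntegral.integral_mono_on hzx
            (intervalIntegrable_const (c := interim μ (myersonQ ψ) i z)) (hii i z x)
            (fun s hs => hmono i z s hz hs.1)
          rw [intervalIntegral.integral_const, smul_eq_mul] at this
          linarith
        · have := intervalIntegral.integral_mono_on hzx (hii i x z)
            (intervalIntegrable_const (c := interim μ (myersonQ ψ) i z))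
            (fun s hs => hmono i s z (hx.trans hs.1) hs.2)
          rw [intervalIntegral.integral_const, smul_eq_mul] at this
          rw [intervalIntegral.integral_symm]
          linarith
      linarith
    · intro i x hx
      rw [hP]
      have := intervalIntegral.integral_nonneg (μ := volume) hx fun s _ => (h01 i s).1
      linarith
    · simp only [hP]
      exact revM.2.2
end

section
/- Let X₁, …, Xₙ be i.i.d. with regular cdf F, density f and finite expectation, with virtual value ψ. Then (i) E[ψ(maxᵢ Xᵢ)] = E[X⁽²⁾], where X⁽²⁾ denotes the second-highest of X₁, …, Xₙ; and (ii) for every measurable allocation q: [0,∞)ⁿ → [0,1]ⁿ with Σᵢ qᵢ(x) = 1 for all x, E[Σᵢ ψ(Xᵢ) qᵢ(X)] ≤ E[ψ(maxᵢ Xᵢ)] = E[X⁽²⁾]. In particular, in the symmetric regular case the Vickrey auction (second-price auction with no reserve price), whose revenue is E[X⁽²⁾], is revenue-maximizing among all incentive-compatible, individually-rational auctions in which the item is always allocated. -/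
open MeasureTheory Set

/-- The highest of `n ≥ 2` values. -/
noncomputable def maxOf {n : ℕ} (hn : 2 ≤ n) (x : Fin n → ℝ) : ℝ :=
  Finset.univ.sup' ⟨⟨0, by omega⟩, Finset.mem_univ _⟩ x

/-- The second-highest of `n ≥ 2` values. -/
noncomputable def secondHighest {n : ℕ} (hn : 2 ≤ n) (x : Fin n → ℝ) : ℝ :=
  Finset.univ.sup' ⟨⟨0, by omega⟩, Finset.mem_univ _⟩ fun i =>
    min (x i)
      ((Finset.univ.erase i).sup'
        (by
          rw [← Finset.card_pos, Finset.card_erase_of_mem (Finset.mem_univ i),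
            Finset.card_univ, Fintype.card_fin]
          omega)
        x)

section OneDim

variable {F f ψ : ℝ → ℝ} {μ : Measure ℝ}

lemma aux_nonneg (hμ : μ = valueMeasure f) : ∀ᵐ x ∂μ, 0 ≤ x := by
  rw [hμ, valueMeasure]
  exact (withDensity_absolutelyContinuous _ _).ae_le (ae_restrict_mem measurableSet_Ici)

lemma aux_noatoms (hμ : μ = valueMeasure f) (a : ℝ) : μ {a} = 0 := by
  rw [hμ, valueMeasure]
  apply withDensity_absolutelyContinuous
  simp

lemma aux_F_meas (hf_cont : Continuous f) (hF : ∀ x, F x = ∫ t in (0:ℝ)..x, f t) :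
    Measurable F := by
  have : F = fun x => ∫ t in (0:ℝ)..x, f t := funext hF
  rw [this]
  exact (intervalIntegral.continuous_primitive
    (fun a b => hf_cont.intervalIntegrable a b) 0).measurable

lemma aux_tail (hf_cont : Continuous f) (hf_pos : ∀ x, 0 ≤ x → 0 < f x)
    (hF : ∀ x, F x = ∫ t in (0:ℝ)..x, f t) (hμ : μ = valueMeasure f)
    (hprob : IsProbabilityMeasure μ) {t : ℝ} (ht : 0 ≤ t) :
    μ (Ioi t) = ENNReal.ofReal (1 - F t) := by
  have h1 : μ (Iic t) = ENNReal.ofReal (F t) := by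
    rw [hF, hμ, valueMeasure, withDensity_apply _ measurableSet_Iic,
      Measure.restrict_restrict measurableSet_Iic, intervalIntegral.integral_of_le ht,
      ← integral_Icc_eq_integral_Ioc, ofReal_integral_eq_lintegral_ofReal]
    · congr 2
      ext x
      simp [and_comm]
    · exact hf_cont.continuousOn.integrableOn_Icc
    · filter_upwards [ae_restrict_mem measurableSet_Icc] with x hx
      exact (hf_pos x hx.1).le
  have h0 : 0 ≤ F t := by
    rw [hF]
    exact intervalIntegral.integral_nonneg ht fun u hu => (hf_pos u hu.1).le
  rw [← compl_Iic, prob_compl_eq_one_sub measurableSet_Iic, h1, ENNReal.ofReal_sub _ h0,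
    ENNReal.ofReal_one]

lemma aux_F_le (hf_cont : Continuous f) (hf_pos : ∀ x, 0 ≤ x → 0 < f x)
    (hF : ∀ x, F x = ∫ t in (0:ℝ)..x, f t) (hμ : μ = valueMeasure f)
    (hprob : IsProbabilityMeasure μ) {t : ℝ} (ht : 0 ≤ t) : 0 ≤ 1 - F t := by
  have h1 : μ (Iic t) = ENNReal.ofReal (F t) := by
    rw [hF, hμ, valueMeasure, withDensity_apply _ measurableSet_Iic,
      Measure.restrict_restrict measurableSet_Iic, intervalIntegral.integral_of_le ht,
      ← integral_Icc_eq_integral_Ioc, ofReal_integral_eq_lintegral_ofReal]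
    · congr 2
      ext x
      simp [and_comm]
    · exact hf_cont.continuousOn.integrableOn_Icc
    · filter_upwards [ae_restrict_mem measurableSet_Icc] with x hx
      exact (hf_pos x hx.1).le
  have h2 : μ (Iic t) ≤ 1 := prob_le_one
  rw [h1, ENNReal.ofReal_le_one] at h2
  linarith

lemma aux_lint (hf_cont : Continuous f) (hf_pos : ∀ x, 0 ≤ x → 0 < f x)
    (hF : ∀ x, F x = ∫ t in (0:ℝ)..x, f t) (hμ : μ = valueMeasure f)
    (hprob : IsProbabilityMeasure μ) {m : ℝ} (hm : 0 ≤ m) :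
    ∫⁻ t in Ioi m, ENNReal.ofReal ((1 - F t) / f t) ∂μ
      = ∫⁻ t, ENNReal.ofReal (max (t - m) 0) ∂μ := by
  have hFm := aux_F_meas hf_cont hF
  have hqm : Measurable fun t => ENNReal.ofReal ((1 - F t) / f t) :=
    ((measurable_const.sub hFm).div hf_cont.measurable).ennreal_ofReal
  have e1 : ∫⁻ t in Ioi m, ENNReal.ofReal ((1 - F t) / f t) ∂μ
      = ∫⁻ t in Ioi m, ENNReal.ofReal (1 - F t) := by
    rw [hμ, valueMeasure, restrict_withDensity measurableSet_Ioi,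
      Measure.restrict_restrict measurableSet_Ioi,
      inter_eq_left.2 (show Ioi m ⊆ Ici 0 from fun x hx => hm.trans (le_of_lt hx)),
      lintegral_withDensity_eq_lintegral_mul _ hf_cont.measurable.ennreal_ofReal
        hqm]
    refine setLIntegral_congr_fun measurableSet_Ioi fun x hx => ?_
    have hp := hf_pos x (hm.trans (le_of_lt hx))
    simp only [Pi.mul_apply]
    rw [← ENNReal.ofReal_mul hp.le, mul_div_cancel₀ _ hp.ne']
  have e2 : ∫⁻ t, ENNReal.ofReal (max (t - m) 0) ∂μ
      = ∫⁻ s in Ioi 0, ENNReal.ofReal (1 - F (s + m)) := by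
    rw [lintegral_eq_lintegral_meas_lt (f := fun t => max (t - m) 0) μ
      (Filter.Eventually.of_forall fun x => le_max_right _ _)
      (by fun_prop)]
    refine setLIntegral_congr_fun measurableSet_Ioi fun s hs => ?_
    have hs' : 0 < s := hs
    rw [← aux_tail hf_cont hf_pos hF hμ hprob (by linarith : 0 ≤ s + m)]
    congr 1
    ext x
    simp only [mem_setOf_eq, mem_Ioi, lt_max_iff]
    constructor
    · rintro (h | h) <;> linarith
    · intro h
      left
      linarith
  rw [e1, e2]
  have := (measurePreserving_add_right (volume : Measure ℝ) m).setLIntegral_comp_preimage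
    (measurableSet_Ioi (a := m)) (f := fun t => ENNReal.ofReal (1 - F t))
    ((measurable_const.sub hFm).ennreal_ofReal)
  rw [← this]
  congr 2
  ext x
  simp

lemma aux_psi_meas (hf_cont : Continuous f) 
    (hF : ∀ x, F x = ∫ t in (0:ℝ)..x, f t) (hψ : ∀ x, ψ x = x - (1 - F x) / f x) :
    Measurable ψ := by
  have : ψ = fun x => x - (1 - F x) / f x := funext hψ
  rw [this]
  exact measurable_id.sub ((measurable_const.sub (aux_F_meas hf_cont hF)).div hf_cont.measurable)

lemma aux_int (hexp : Integrable (fun x => x) μ) (hprob : IsProbabilityMeasure μ) (m : ℝ) :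
    Integrable (fun t => max (t - m) 0) μ :=
  (hexp.sub (integrable_const m)).pos_part

lemma aux_hazard_int (hf_cont : Continuous f) (hf_pos : ∀ x, 0 ≤ x → 0 < f x)
    (hF : ∀ x, F x = ∫ t in (0:ℝ)..x, f t) (hμ : μ = valueMeasure f)
    (hprob : IsProbabilityMeasure μ) (hexp : Integrable (fun x => x) μ) :
    Integrable (fun t => (1 - F t) / f t) μ := by
  have hFm := aux_F_meas hf_cont hF
  have hr : μ.restrict (Ioi 0) = μ := by
    rw [Measure.restrict_eq_self_of_ae_mem]
    have h0 : ∀ᵐ x ∂μ, x ≠ 0 := by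
      rw [ae_iff]
      simpa using aux_noatoms hμ 0
    filter_upwards [aux_nonneg hμ, h0] with x h1 h2
    exact lt_of_le_of_ne h1 (Ne.symm h2)
  refine ⟨((measurable_const.sub hFm).div hf_cont.measurable).aestronglyMeasurable, ?_⟩
  rw [hasFiniteIntegral_iff_ofReal]
  · rw [← hr, aux_lint hf_cont hf_pos hF hμ hprob le_rfl,
      ← ofReal_integral_eq_lintegral_ofReal (aux_int hexp hprob 0)]
    · exact ENNReal.ofReal_lt_top
    · exact Filter.Eventually.of_forall fun x => le_max_right _ _
  · filter_upwards [aux_nonneg hμ] with x hx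
    exact div_nonneg (aux_F_le hf_cont hf_pos hF hμ hprob hx) (hf_pos x hx).le

lemma aux_key_s11 (hf_cont : Continuous f) (hf_pos : ∀ x, 0 ≤ x → 0 < f x)
    (hF : ∀ x, F x = ∫ t in (0:ℝ)..x, f t) (hψ : ∀ x, ψ x = x - (1 - F x) / f x)
    (hμ : μ = valueMeasure f)
    (hprob : IsProbabilityMeasure μ) (hexp : Integrable (fun x => x) μ) {m : ℝ} (hm : 0 ≤ m) :
    ∫ t, (Ioi m).indicator (fun t => ψ t - m) t ∂μ = 0 := by
  have hFm := aux_F_meas hf_cont hF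
  have hz := aux_hazard_int hf_cont hf_pos hF hμ hprob hexp
  have e : ∫ t in Ioi m, (1 - F t) / f t ∂μ = ∫ t, max (t - m) 0 ∂μ := by
    rw [integral_eq_lintegral_of_nonneg_ae, integral_eq_lintegral_of_nonneg_ae,
      aux_lint hf_cont hf_pos hF hμ hprob hm]
    · exact Filter.Eventually.of_forall fun x => le_max_right _ _
    · exact (aux_int hexp hprob m).1
    · filter_upwards [ae_restrict_mem measurableSet_Ioi] with x hx
      have hx : 0 ≤ x := hm.trans (le_of_lt hx)
      exact div_nonneg (aux_F_le hf_cont hf_pos hF hμ hprob hx) (hf_pos x hx).le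
    · exact hz.1.restrict
  have e2 : ∫ t, max (t - m) 0 ∂μ = ∫ t in Ioi m, (t - m) ∂μ := by
    rw [← integral_indicator measurableSet_Ioi]
    congr 1
    ext t
    by_cases h : m < t
    · simp [indicator, h, h.le]
    · simp [indicator, h, not_lt.1 h]
  rw [integral_indicator measurableSet_Ioi]
  have e3 : ∀ t, ψ t - m = (t - m) - (1 - F t) / f t := fun t => by rw [hψ]; ring
  simp_rw [e3]
  have hi : Integrable (fun t => t - m) μ := hexp.sub (integrable_const m)
  rw [integral_sub hi.integrableOn hz.integrableOn, e, e2, sub_self]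

end OneDim

section MultiDim

variable {F f ψ : ℝ → ℝ} {μ : Measure ℝ}

/-- The highest of the values of the opponents of bidder `i`. -/
noncomputable def othersMax {n : ℕ} (hn : 2 ≤ n) (x : Fin n → ℝ) (i : Fin n) : ℝ :=
  (Finset.univ.erase i).sup'
        (by
          rw [← Finset.card_pos, Finset.card_erase_of_mem (Finset.mem_univ i),
            Finset.card_univ, Fintype.card_fin]
          omega)
        x

lemma le_maxOf {n : ℕ} (hn : 2 ≤ n) (x : Fin n → ℝ) (i : Fin n) : x i ≤ maxOf hn x :=
  Finset.le_sup' x (Finset.mem_univ i)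

lemma exists_maxOf {n : ℕ} (hn : 2 ≤ n) (x : Fin n → ℝ) : ∃ i, maxOf hn x = x i := by
  obtain ⟨i, -, h⟩ := Finset.exists_mem_eq_sup' (s := (Finset.univ : Finset (Fin n)))
    ⟨⟨0, by omega⟩, Finset.mem_univ _⟩ x
  exact ⟨i, h⟩

lemma le_othersMax {n : ℕ} (hn : 2 ≤ n) (x : Fin n → ℝ) {i j : Fin n} (h : j ≠ i) :
    x j ≤ othersMax hn x i :=
  Finset.le_sup' x (Finset.mem_erase.2 ⟨h, Finset.mem_univ j⟩)

lemma exists_othersMax {n : ℕ} (hn : 2 ≤ n) (x : Fin n → ℝ) (i : Fin n) :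
    ∃ j, j ≠ i ∧ othersMax hn x i = x j := by
  obtain ⟨j, hj, h⟩ := Finset.exists_mem_eq_sup' (s := Finset.univ.erase i)
    (by
      rw [← Finset.card_pos, Finset.card_erase_of_mem (Finset.mem_univ i),
        Finset.card_univ, Fintype.card_fin]
      omega) x
  exact ⟨j, (Finset.mem_erase.1 hj).1, h⟩

lemma secondHighest_eq {n : ℕ} (hn : 2 ≤ n) (x : Fin n → ℝ) (i : Fin n)
    (h : othersMax hn x i < x i) : secondHighest hn x = othersMax hn x i := by
  apply le_antisymm
  · refine Finset.sup'_le _ _ fun j _ => ?_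
    by_cases hj : j = i
    · subst hj
      exact min_le_right _ _
    · exact (min_le_left _ _).trans (le_othersMax hn x hj)
  · have : min (x i) (othersMax hn x i) ≤ secondHighest hn x :=
      Finset.le_sup' (fun i => min (x i) (othersMax hn x i)) (Finset.mem_univ i)
    rwa [min_eq_right h.le] at this

lemma measurable_maxOf {n : ℕ} (hn : 2 ≤ n) : Measurable (maxOf hn) := by
  have := Finset.measurable_sup' (s := (Finset.univ : Finset (Fin n)))
    ⟨⟨0, by omega⟩, Finset.mem_univ _⟩ (f := fun i (x : Fin n → ℝ) => x i)
    (fun i _ => measurable_pi_apply i)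
  convert this using 1
  ext x
  exact (Finset.sup'_apply _ (fun i (x : Fin n → ℝ) => x i) x).symm

lemma measurable_othersMax {n : ℕ} (hn : 2 ≤ n) (i : Fin n) :
    Measurable fun x => othersMax hn x i := by
  have := Finset.measurable_sup' (s := Finset.univ.erase i)
    (by
      rw [← Finset.card_pos, Finset.card_erase_of_mem (Finset.mem_univ i),
        Finset.card_univ, Fintype.card_fin]
      omega) (f := fun i (x : Fin n → ℝ) => x i)
    (fun i _ => measurable_pi_apply i)
  convert this using 1
  ext x
  simp [othersMax, Finset.sup'_apply]

lemma measurable_secondHighest {n : ℕ} (hn : 2 ≤ n) : Measurable (secondHighest hn) := by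
  have := Finset.measurable_sup' (s := (Finset.univ : Finset (Fin n)))
    ⟨⟨0, by omega⟩, Finset.mem_univ _⟩
    (f := fun i (x : Fin n → ℝ) => min (x i) (othersMax hn x i))
    (fun i _ => (measurable_pi_apply i).min (measurable_othersMax hn i))
  convert this using 1
  ext x
  exact (Finset.sup'_apply _ (fun i (x : Fin n → ℝ) => min (x i) (othersMax hn x i)) x).symm

lemma exists_secondHighest {n : ℕ} (hn : 2 ≤ n) (x : Fin n → ℝ) :
    ∃ i, secondHighest hn x = x i := by
  obtain ⟨i, -, h⟩ := Finset.exists_mem_eq_sup' (s := (Finset.univ : Finset (Fin n)))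
    ⟨⟨0, by omega⟩, Finset.mem_univ _⟩ (fun i => min (x i) (othersMax hn x i))
  have h' : secondHighest hn x = min (x i) (othersMax hn x i) := h
  rcases min_choice (x i) (othersMax hn x i) with h2 | h2
  · exact ⟨i, h'.trans h2⟩
  · obtain ⟨j, -, hj⟩ := exists_othersMax hn x i
    exact ⟨j, (h'.trans h2).trans hj⟩

lemma integrable_coord {n : ℕ} (hprob : IsProbabilityMeasure μ) {g : ℝ → ℝ}
    (hg : Integrable g μ) (i : Fin n) :
    Integrable (fun x : Fin n → ℝ => g (x i)) (Measure.pi fun _ => μ) :=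
  (measurePreserving_eval (fun _ : Fin n => μ) i).integrable_comp_of_integrable hg

lemma integrable_sel {n : ℕ} (hprob : IsProbabilityMeasure μ) {g : ℝ → ℝ}
    (hgm : Measurable g) (hg : Integrable g μ) {s : (Fin n → ℝ) → ℝ} (hs : Measurable s)
    (h : ∀ x, ∃ i, s x = x i) :
    Integrable (fun x : Fin n → ℝ => g (s x)) (Measure.pi fun _ => μ) := by
  have hb : Integrable (fun x : Fin n → ℝ => ∑ i, |g (x i)|) (Measure.pi fun _ => μ) :=
    integrable_finsetSum _ fun i _ => (integrable_coord hprob hg i).abs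
  refine hb.mono' (hgm.comp hs).aestronglyMeasurable (Filter.Eventually.of_forall fun x => ?_)
  obtain ⟨i, hi⟩ := h x
  rw [hi, Real.norm_eq_abs]
  exact Finset.single_le_sum (f := fun i => |g (x i)|) (fun j _ => abs_nonneg _)
    (Finset.mem_univ i)

lemma ae_coord_nonneg {n : ℕ} (hμ : μ = valueMeasure f) (hprob : IsProbabilityMeasure μ) :
    ∀ᵐ x : Fin n → ℝ ∂(Measure.pi fun _ => μ), ∀ i, 0 ≤ x i := by
  rw [ae_all_iff]
  intro i
  exact (measurePreserving_eval (fun _ : Fin n => μ) i).quasiMeasurePreserving.ae (aux_nonneg hμ)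

/-- Splitting off coordinate `i`: the opponents' maximum as a function of the other values. -/
lemma othersMax_factor {k : ℕ} (hn : 2 ≤ k + 1) (i : Fin (k + 1)) (a b : ℝ) (y : Fin k → ℝ) :
    othersMax hn (i.insertNth a y : Fin (k + 1) → ℝ) i
      = othersMax hn (i.insertNth b y : Fin (k + 1) → ℝ) i := by
  unfold othersMax
  refine Finset.sup'_congr _ rfl fun j hj => ?_
  obtain ⟨l, rfl⟩ := Fin.exists_succAbove_eq (Finset.mem_erase.1 hj).1
  simp

lemma measurable_ins {k : ℕ} (i : Fin (k + 1)) :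
    Measurable fun p : ℝ × (Fin k → ℝ) => (i.insertNth p.1 p.2 : Fin (k + 1) → ℝ) :=
  (MeasurableEquiv.piFinSuccAbove (fun _ : Fin (k+1) => ℝ) i).symm.measurable

lemma mp_ins {k : ℕ} (hprob : IsProbabilityMeasure μ) (i : Fin (k + 1)) :
    MeasurePreserving (MeasurableEquiv.piFinSuccAbove (fun _ : Fin (k+1) => ℝ) i).symm
      (μ.prod (Measure.pi fun _ : Fin k => μ)) (Measure.pi fun _ => μ) :=
  (measurePreserving_piFinSuccAbove (fun _ : Fin (k+1) => μ) i).symm _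

lemma ae_no_tie {n : ℕ} (hn : 2 ≤ n) (hμ : μ = valueMeasure f) (hprob : IsProbabilityMeasure μ)
    (i : Fin n) : ∀ᵐ x : Fin n → ℝ ∂(Measure.pi fun _ => μ), x i ≠ othersMax hn x i := by
  obtain ⟨k, rfl⟩ : ∃ k, n = k + 1 := ⟨n - 1, by omega⟩
  have hms : MeasurableSet {x : Fin (k+1) → ℝ | x i = othersMax hn x i} :=
    measurableSet_eq_fun (measurable_pi_apply i) (measurable_othersMax hn i)
  rw [ae_iff]
  simp only [ne_eq, not_not]
  rw [← (mp_ins hprob i).measure_preimage hms.nullMeasurableSet,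
    Measure.prod_apply_symm ((mp_ins hprob i).measurable hms), lintegral_eq_zero_iff']
  · refine Filter.Eventually.of_forall fun y => ?_
    refine measure_mono_null ?_
      (aux_noatoms hμ (othersMax hn (i.insertNth 0 y : Fin (k + 1) → ℝ) i))
    intro a ha
    have ha' : (i.insertNth a y : Fin (k + 1) → ℝ) i
      = othersMax hn (i.insertNth a y : Fin (k + 1) → ℝ) i := ha
    rw [othersMax_factor hn i a 0] at ha'
    simpa using ha'
  · exact (measurable_measure_prodMk_right ((mp_ins hprob i).measurable hms)).aemeasurable

/-- The contribution of bidder `i` to `ψ(max) - second`. -/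
noncomputable def contrib {n : ℕ} (hn : 2 ≤ n) (ψ : ℝ → ℝ) (i : Fin n) (x : Fin n → ℝ) : ℝ :=
  {x : Fin n → ℝ | othersMax hn x i < x i}.indicator (fun x => ψ (x i) - othersMax hn x i) x

lemma contrib_integrable {n : ℕ} (hn : 2 ≤ n) (hprob : IsProbabilityMeasure μ)
    (hexp : Integrable (fun x => x) μ) (hψi : Integrable ψ μ) (i : Fin n) :
    Integrable (contrib hn ψ i) (Measure.pi fun _ => μ) := by
  refine Integrable.indicator ?_ (measurableSet_lt (measurable_othersMax hn i)
    (measurable_pi_apply i))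
  refine (integrable_coord hprob hψi i).sub ?_
  exact integrable_sel hprob measurable_id hexp (measurable_othersMax hn i)
    (fun x => let ⟨j, _, hj⟩ := exists_othersMax hn x i; ⟨j, hj⟩)

lemma contrib_integral {n : ℕ} (hn : 2 ≤ n) (hμ : μ = valueMeasure f)
    (hprob : IsProbabilityMeasure μ)
    (hexp : Integrable (fun x => x) μ) (hψi : Integrable ψ μ)
    (hkey : ∀ m, 0 ≤ m → ∫ t, (Ioi m).indicator (fun t => ψ t - m) t ∂μ = 0) (i : Fin n) :
    ∫ x, contrib hn ψ i x ∂(Measure.pi fun _ => μ) = 0 := by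
  have hint := contrib_integrable hn hprob hexp hψi i
  obtain ⟨k, rfl⟩ : ∃ k, n = k + 1 := ⟨n - 1, by omega⟩
  have hmp := mp_ins (k := k) hprob i
  rw [← hmp.integral_comp', integral_prod_symm]
  · refine integral_eq_zero_of_ae ?_
    filter_upwards [ae_coord_nonneg hμ hprob] with y hy
    set m := othersMax hn (i.insertNth 0 y : Fin (k + 1) → ℝ) i with hm
    have hm0 : 0 ≤ m := by
      obtain ⟨j, hj, h⟩ := exists_othersMax hn (i.insertNth 0 y : Fin (k + 1) → ℝ) i
      obtain ⟨l, rfl⟩ := Fin.exists_succAbove_eq hj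
      rw [hm, h]
      simpa using hy l
    rw [Pi.zero_apply, ← hkey m hm0]
    congr 1
    ext a
    change contrib hn ψ i (i.insertNth a y : Fin (k + 1) → ℝ) = _
    simp only [contrib, indicator, mem_setOf_eq, mem_Ioi, othersMax_factor hn i a 0, ← hm,
      Fin.insertNth_apply_same]
  · exact hmp.integrable_comp_of_integrable hint

lemma sum_contrib {n : ℕ} (hn : 2 ≤ n) (x : Fin n → ℝ) (h : ∀ i, x i ≠ othersMax hn x i) :
    ∑ i, contrib hn ψ i x = ψ (maxOf hn x) - secondHighest hn x := by
  obtain ⟨i, hi⟩ := exists_maxOf hn x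
  have hlt : othersMax hn x i < x i := by
    refine lt_of_le_of_ne ?_ (h i).symm
    obtain ⟨j, -, hj⟩ := exists_othersMax hn x i
    rw [hj, ← hi]
    exact le_maxOf hn x j
  rw [Finset.sum_eq_single i]
  · rw [secondHighest_eq hn x i hlt, hi]
    simp [contrib, indicator, hlt]
  · intro j _ hj
    have h1 : x j ≤ othersMax hn x i := le_othersMax hn x hj
    have h2 : x i ≤ othersMax hn x j := le_othersMax hn x (Ne.symm hj)
    have : ¬ othersMax hn x j < x j := by linarith
    simp [contrib, indicator, this]
  · simp

end MultiDim

/-- **The Vickrey auction is optimal among auctions that always allocate** (symmetric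
regular case): (i) `E[ψ(maxᵢ Xᵢ)] = E[X⁽²⁾]`, the expected second-highest value (the
Vickrey revenue); and (ii) every allocation `q` with `∑ᵢ qᵢ(x) = 1` satisfies
`E[∑ᵢ ψ(Xᵢ) qᵢ(X)] ≤ E[ψ(maxᵢ Xᵢ)]`. -/
theorem vickrey_optimal_among_always_allocating
    (n : ℕ) (hn : 2 ≤ n)
    (F f ψ : ℝ → ℝ)
    (hf_cont : Continuous f) (hf_pos : ∀ x, 0 ≤ x → 0 < f x)
    (hF : ∀ x, F x = ∫ t in (0:ℝ)..x, f t)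
    (hψ : ∀ x, ψ x = x - (1 - F x) / f x)
    (hreg : StrictMonoOn ψ (Ici 0))
    (μ : Measure ℝ) (hμ : μ = valueMeasure f)
    (hprob : IsProbabilityMeasure μ)
    (hexp : Integrable (fun x => x) μ) :
    (∫ x : Fin n → ℝ, ψ (maxOf hn x) ∂(Measure.pi fun _ => μ))
        = (∫ x : Fin n → ℝ, secondHighest hn x ∂(Measure.pi fun _ => μ)) ∧
      ∀ q : (Fin n → ℝ) → Fin n → ℝ,
        (∀ i, Measurable fun x => q x i) →
        (∀ x i, q x i ∈ Icc (0:ℝ) 1) →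
        (∀ x, (∑ i, q x i) = 1) →
        (∫ x : Fin n → ℝ, (∑ i, ψ (x i) * q x i) ∂(Measure.pi fun _ => μ))
          ≤ ∫ x : Fin n → ℝ, ψ (maxOf hn x) ∂(Measure.pi fun _ => μ) := by
  have hψm := aux_psi_meas hf_cont hF hψ
  have hψi : Integrable ψ μ := by
    have : ψ = fun x => x - (1 - F x) / f x := funext hψ
    rw [this]
    exact hexp.sub (aux_hazard_int hf_cont hf_pos hF hμ hprob hexp)
  have hmax : Integrable (fun x : Fin n → ℝ => ψ (maxOf hn x)) (Measure.pi fun _ => μ) :=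
    integrable_sel hprob hψm hψi (measurable_maxOf hn) (exists_maxOf hn)
  have hsec : Integrable (fun x : Fin n → ℝ => secondHighest hn x) (Measure.pi fun _ => μ) :=
    integrable_sel hprob measurable_id hexp (measurable_secondHighest hn)
      (exists_secondHighest hn)
  refine ⟨?_, ?_⟩
  · rw [← sub_eq_zero, ← integral_sub hmax hsec]
    have hae : (fun x : Fin n → ℝ => ψ (maxOf hn x) - secondHighest hn x)
        =ᵐ[Measure.pi fun _ => μ] fun x => ∑ i, contrib hn ψ i x := by
      filter_upwards [ae_all_iff.2 (ae_no_tie hn hμ hprob)] with x hx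
      exact (sum_contrib hn x hx).symm
    rw [integral_congr_ae hae,
      integral_finsetSum _ fun i _ => contrib_integrable hn hprob hexp hψi i]
    exact Finset.sum_eq_zero fun i _ => contrib_integral hn hμ hprob hexp hψi
      (fun m hm => aux_key_s11 hf_cont hf_pos hF hψ hμ hprob hexp hm) i
  · intro q hqm hq hsum
    refine integral_mono_ae ?_ hmax ?_
    · refine integrable_finsetSum _ fun i _ => ?_
      refine (integrable_coord hprob hψi i).mul_bdd (c := 1) (hqm i).aestronglyMeasurable
        (Filter.Eventually.of_forall fun x => ?_)
      rw [Real.norm_eq_abs, abs_of_nonneg (hq x i).1]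
      exact (hq x i).2
    · filter_upwards [ae_coord_nonneg hμ hprob] with x hx
      calc ∑ i, ψ (x i) * q x i ≤ ∑ i, ψ (maxOf hn x) * q x i := by
            refine Finset.sum_le_sum fun i _ => mul_le_mul_of_nonneg_right ?_ (hq x i).1
            exact hreg.monotoneOn (hx i) ((hx i).trans (le_maxOf hn x i)) (le_maxOf hn x i)
        _ = ψ (maxOf hn x) := by rw [← Finset.mul_sum, hsum, mul_one]
end

section
/- Let F be a regular cdf on [0,∞) with density f, finite expectation, and virtual value ψ, and let n ≥ 2. Let X₁, …, Xₙ be i.i.d. ∼ F. Then the Vickrey auction with n bidders is a ((n−1)/n)-approximation of the Myerson auction with n bidders: E[ second-highest of X₁, …, Xₙ ] ≥ (1 − 1/n) · E[ max(0, maxᵢ ψ(Xᵢ)) ]. A key step is the per-bidder payment monotonicity in the Myerson auction: with r* the monopoly price of F, ∫ (x f(x) − (1 − F(x))) F^{n−1}(x) 1{x ≥ r*} dx ≥ ∫ (x f(x) − (1 − F(x))) Fⁿ(x) 1{x ≥ r*} dx. -/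
open MeasureTheory Set

lemma vm_integral (f : ℝ → ℝ) (hf_cont : Continuous f) (hf_pos : ∀ x, 0 ≤ x → 0 < f x)
    (g : ℝ → ℝ) (m : ℝ) (hm : 0 ≤ m) :
    ∫ t in Ioi m, g t ∂(valueMeasure f) = ∫ t in Ioi m, g t * f t := by
  unfold valueMeasure
  rw [restrict_withDensity measurableSet_Ioi, Measure.restrict_restrict measurableSet_Ioi,
    inter_eq_left.2 (Ioi_subset_Ici hm),
    integral_withDensity_eq_integral_toReal_smul (by fun_prop) (by simp)]
  refine setIntegral_congr_fun measurableSet_Ioi fun t ht => ?_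
  have := hf_pos t (hm.trans (le_of_lt ht))
  simp [ENNReal.toReal_ofReal this.le, mul_comm]

lemma vm_integrable (f : ℝ → ℝ) (hf_cont : Continuous f) (hf_pos : ∀ x, 0 ≤ x → 0 < f x)
    (g : ℝ → ℝ) :
    Integrable g (valueMeasure f) ↔ IntegrableOn (fun t => g t * f t) (Ioi 0) := by
  unfold valueMeasure
  rw [integrable_withDensity_iff (by fun_prop) (by simp), ← IntegrableOn,
    integrableOn_Ici_iff_integrableOn_Ioi]
  refine integrableOn_congr_fun (fun t ht => ?_) measurableSet_Ioi
  have := hf_pos t (le_of_lt ht)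
  simp [ENNReal.toReal_ofReal this.le]

lemma one_dim (F f ψ : ℝ → ℝ)
    (hf_cont : Continuous f) (hf_pos : ∀ x, 0 ≤ x → 0 < f x)
    (hF : ∀ x, F x = ∫ t in (0:ℝ)..x, f t)
    (hψ : ∀ x, ψ x = x - (1 - F x) / f x)
    (μ : Measure ℝ) (hμ : μ = valueMeasure f)
    (hprob : IsProbabilityMeasure μ)
    (hexp : Integrable (fun x => x) μ) :
    (∀ᵐ x ∂μ, 0 ≤ x) ∧ NullSingletonClass μ ∧ Integrable ψ μ ∧ Measurable ψ ∧ ∫ x, ψ x ∂μ = 0 ∧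
    (∀ m, 0 ≤ m → ∫ t in Ioi m, ψ t ∂μ = m * μ.real (Ioi m)) ∧
    IntegrableOn (fun x => x * f x - (1 - F x)) (Ioi 0) ∧
    (∀ x, 0 ≤ x → 0 ≤ F x ∧ F x ≤ 1) ∧ Continuous F := by
  have hac : μ ≪ volume.restrict (Ici 0) := by
    rw [hμ]; exact withDensity_absolutelyContinuous _ _
  have hnonneg : ∀ᵐ x ∂μ, (0 : ℝ) ≤ x := hac.ae_le (ae_restrict_mem measurableSet_Ici)
  have hna : NullSingletonClass μ := ⟨fun x => hac (by simp)⟩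
  have hfint : IntegrableOn f (Ioi 0) := by
    have := (vm_integrable f hf_cont hf_pos (fun _ => 1)).1 (by rw [← hμ]; exact integrable_const _)
    simpa using this
  have hFd : ∀ x, HasDerivAt F (f x) x := by
    intro x
    have : F = fun x => ∫ t in (0:ℝ)..x, f t := funext hF
    rw [this]
    exact hf_cont.integral_hasStrictDerivAt 0 x |>.hasDerivAt
  have hFc : Continuous F := continuous_iff_continuousAt.2 fun x => (hFd x).continuousAt
  have hIoi : ∀ m, 0 ≤ m → μ.real (Ioi m) = ∫ t in Ioi m, f t := by
    intro m hm
    have := vm_integral f hf_cont hf_pos (fun _ => 1) m hm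
    rw [← hμ] at this
    simpa using this
  have h0 : μ.real (Ioi 0) = 1 := by
    rw [← probReal_univ (μ := μ)]
    apply measureReal_congr
    have : ∀ᵐ x ∂μ, x ≠ 0 := by simp [ae_iff]
    filter_upwards [hnonneg, this] with x hx hx'
    exact propext ⟨fun _ => trivial, fun _ => lt_of_le_of_ne hx hx'.symm⟩
  have hG : ∀ m, 0 ≤ m → μ.real (Ioi m) = 1 - F m := by
    intro m hm
    have := intervalIntegral.integral_Ioi_sub_Ioi hfint hm
    rw [← hIoi 0 le_rfl, ← hIoi m hm, ← hF, h0] at this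
    linarith
  have hF01 : ∀ x, 0 ≤ x → 0 ≤ F x ∧ F x ≤ 1 := by
    intro x hx
    have h1 := hG x hx
    have h2 : 0 ≤ μ.real (Ioi x) := measureReal_nonneg
    have h3 : μ.real (Ioi x) ≤ 1 := measureReal_le_one
    constructor <;> linarith
  have hxf : IntegrableOn (fun x => x * f x) (Ioi 0) := by
    rw [hμ] at hexp
    exact (vm_integrable f hf_cont hf_pos _).1 hexp
  have hGint : IntegrableOn (fun x => 1 - F x) (Ioi 0) := by
    refine ⟨by fun_prop, ?_⟩
    have h := lintegral_eq_lintegral_meas_lt μ hnonneg aemeasurable_id'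
    have h2 : ∫⁻ x, ENNReal.ofReal x ∂μ < ⊤ := by
      refine lt_of_le_of_lt (lintegral_mono fun x => ?_) hexp.2
      exact Real.ofReal_le_enorm x
    rw [h] at h2
    refine lt_of_eq_of_lt ?_ h2
    refine setLIntegral_congr_fun measurableSet_Ioi fun t ht => ?_
    have ht' : 0 ≤ t := le_of_lt ht
    have : {a : ℝ | t < a} = Ioi t := rfl
    simp only [this]
    rw [Real.enorm_of_nonneg (by linarith [hF01 t ht']), ← hG t ht', ofReal_measureReal]
  have hint : IntegrableOn (fun x => x * f x - (1 - F x)) (Ioi 0) := hxf.sub hGint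
  have hψf : ∀ x, 0 ≤ x → ψ x * f x = x * f x - (1 - F x) := by
    intro x hx
    have := (hf_pos x hx).ne'
    rw [hψ]; field_simp
  have hψi : Integrable ψ μ := by
    rw [hμ, vm_integrable f hf_cont hf_pos]
    exact hint.congr_fun (fun x hx => (hψf x (le_of_lt hx)).symm) measurableSet_Ioi
  have hψm : Measurable ψ := by
    rw [funext hψ]
    exact measurable_id.sub ((measurable_const.sub hFc.measurable).div hf_cont.measurable)
  have hlim : Filter.Tendsto (fun x => -(x * (1 - F x))) Filter.atTop (nhds 0) := by
    have h1 : Filter.Tendsto (fun x : ℝ => ∫ t in Ioi x, t * f t) Filter.atTop (nhds 0) :=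
      tendsto_integral_Ioi_zero Filter.tendsto_id 
    have : Filter.Tendsto (fun x => x * (1 - F x)) Filter.atTop (nhds 0) := by
      refine tendsto_of_tendsto_of_tendsto_of_le_of_le' tendsto_const_nhds h1 ?_ ?_
      · filter_upwards [Filter.eventually_ge_atTop 0] with x hx
        exact mul_nonneg hx (by linarith [hF01 x hx])
      · filter_upwards [Filter.eventually_ge_atTop 0] with x hx
        rw [← hG x hx, hIoi x hx, ← integral_const_mul]
        refine setIntegral_mono_on ((hfint.mono_set (Ioi_subset_Ioi hx)).const_mul x)
          (hxf.mono_set (Ioi_subset_Ioi hx)) measurableSet_Ioi fun t ht => ?_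
        exact mul_le_mul_of_nonneg_right (le_of_lt ht) (hf_pos t (hx.trans (le_of_lt ht))).le
    simpa using this.neg
  have hpay : ∀ m, 0 ≤ m → ∫ t in Ioi m, ψ t ∂μ = m * μ.real (Ioi m) := by
    intro m hm
    rw [hG m hm, hμ, vm_integral f hf_cont hf_pos _ m hm]
    rw [setIntegral_congr_fun measurableSet_Ioi
      (fun x hx => hψf x (hm.trans (le_of_lt hx)) : EqOn _ (fun x => x * f x - (1 - F x)) _)]
    rw [integral_Ioi_of_hasDerivAt_of_tendsto' (f := fun x => -(x * (1 - F x))) ?_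
      (hint.mono_set (Ioi_subset_Ioi hm)) hlim]
    · ring
    · intro x _
      have := ((hasDerivAt_id x).mul ((hFd x).const_sub 1)).neg
      convert this using 1
      · rfl
      · simp only [id]; ring
  refine ⟨hnonneg, hna, hψi, hψm, ?_, hpay, hint, hF01, hFc⟩
  have := hpay 0 le_rfl
  rw [zero_mul] at this
  rw [← this]
  symm
  apply setIntegral_eq_integral_of_ae_compl_eq_zero
  have : ∀ᵐ x ∂μ, x ≠ 0 := by simp [ae_iff]
  filter_upwards [hnonneg, this] with x hx hx' hx2
  exact absurd (lt_of_le_of_ne hx hx'.symm) hx2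

lemma mp_update {n : ℕ} (μ : Measure ℝ) [IsProbabilityMeasure μ] (i : Fin n) :
    MeasurePreserving (fun p : (Fin n → ℝ) × ℝ => Function.update p.1 i p.2)
      ((Measure.pi fun _ : Fin n => μ).prod μ) (Measure.pi fun _ => μ) := by
  have hm : Measurable (fun p : (Fin n → ℝ) × ℝ => Function.update p.1 i p.2) := by
    refine measurable_pi_lambda _ fun j => ?_
    by_cases h : j = i
    · subst h; simpa using measurable_snd
    · simp only [Function.update_of_ne h]
      exact (measurable_pi_apply j).comp measurable_fst
  refine ⟨hm, ?_⟩
  symm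
  refine Measure.pi_eq fun s hs => ?_
  rw [Measure.map_apply hm (MeasurableSet.univ_pi hs)]
  have : (fun p : (Fin n → ℝ) × ℝ => Function.update p.1 i p.2) ⁻¹' (univ.pi s)
      = (univ.pi (Function.update s i univ)) ×ˢ (s i) := by
    ext p
    simp only [mem_preimage, mem_pi, mem_univ, true_imp_iff, mem_prod]
    constructor
    · intro h
      refine ⟨fun j => ?_, by simpa using h i⟩
      by_cases hj : j = i
      · subst hj; simp
      · simpa [hj] using h j
    · rintro ⟨h1, h2⟩ j
      by_cases hj : j = i
      · subst hj; simpa using h2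
      · simpa [hj] using h1 j
  rw [this, Measure.prod_prod, Measure.pi_pi, ← Finset.mul_prod_erase _ _ (Finset.mem_univ i),
    ← Finset.mul_prod_erase _ (fun j => μ (s j)) (Finset.mem_univ i)]
  rw [Finset.prod_congr rfl (g := fun j => μ (s j))]
  · simp [mul_comm]
  · intro j hj
    simp [Finset.ne_of_mem_erase hj]

lemma integral_update {n : ℕ} (μ : Measure ℝ) [IsProbabilityMeasure μ] (i : Fin n)
    (Φ : (Fin n → ℝ) → ℝ) (h : Integrable Φ (Measure.pi fun _ => μ)) :
    ∫ x, Φ x ∂(Measure.pi fun _ => μ) =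
      ∫ x, ∫ t, Φ (Function.update x i t) ∂μ ∂(Measure.pi fun _ => μ) ∧
    Integrable (fun x => ∫ t, Φ (Function.update x i t) ∂μ) (Measure.pi fun _ : Fin n => μ) := by
  have hmp := mp_update μ i
  have hi : Integrable (fun p : (Fin n → ℝ) × ℝ => Φ (Function.update p.1 i p.2))
      ((Measure.pi fun _ : Fin n => μ).prod μ) := hmp.integrable_comp_of_integrable h
  refine ⟨?_, hi.integral_prod_left⟩
  rw [← integral_prod _ hi]
  conv_lhs => rw [← hmp.map_eq]
  exact integral_map hmp.measurable.aemeasurable (by rw [hmp.map_eq]; exact h.1)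

lemma ae_update {n : ℕ} (μ : Measure ℝ) [IsProbabilityMeasure μ] (i : Fin n)
    (P : (Fin n → ℝ) → Prop) (hP : MeasurableSet {x | P x})
    (h : ∀ x, ∀ᵐ t ∂μ, P (Function.update x i t)) :
    ∀ᵐ x ∂(Measure.pi fun _ : Fin n => μ), P x := by
  have hmp := mp_update μ i
  rw [← hmp.map_eq, ae_map_iff hmp.measurable.aemeasurable hP,
    Measure.ae_prod_iff_ae_ae (p := fun p => P (Function.update p.1 i p.2)) (hmp.measurable hP)]
  exact Filter.Eventually.of_forall h

lemma integrable_sup' {α ι : Type*} [MeasurableSpace α] (π : Measure α) (s : Finset ι)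
    (hs : s.Nonempty) (g : ι → α → ℝ) (hg : ∀ i, Integrable (g i) π) :
    Integrable (fun x => s.sup' hs fun i => g i x) π := by
  have : (fun x => s.sup' hs fun i => g i x) = s.sup' hs g := by
    ext x; rw [Finset.sup'_apply]
  rw [this]
  exact Finset.sup'_induction hs g (p := fun h => Integrable h π)
    (fun a ha b hb => ha.sup hb) (fun b _ => hg b)

lemma measurable_sup'' {n : ℕ} (s : Finset (Fin n)) (hs : s.Nonempty) :
    Measurable (fun x : Fin n → ℝ => s.sup' hs x) := by
  have : (fun x : Fin n → ℝ => s.sup' hs x) = s.sup' hs (fun i x => x i) := by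
    ext x; rw [Finset.sup'_apply]
  rw [this]
  exact Finset.measurable_sup' hs (fun i _ => measurable_pi_apply i)

lemma sup'_erase_update {n : ℕ} (i : Fin n) (hs : (Finset.univ.erase i).Nonempty)
    (g : ℝ → ℝ) (x : Fin n → ℝ) (t : ℝ) :
    ((Finset.univ.erase i).sup' hs fun j => g (Function.update x i t j)) =
      (Finset.univ.erase i).sup' hs fun j => g (x j) := by
  refine Finset.sup'_congr _ rfl fun j hj => ?_
  rw [Function.update_of_ne (Finset.ne_of_mem_erase hj)]

/-- Bulow–Klemperer style step. -/
lemma bk_step {n : ℕ} (μ : Measure ℝ) [IsProbabilityMeasure μ] (ψ : ℝ → ℝ)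
    (hψ : Integrable ψ μ) (h0 : ∫ x, ψ x ∂μ = 0) (i : Fin n)
    (hu : (Finset.univ : Finset (Fin n)).Nonempty) (hs : (Finset.univ.erase i).Nonempty) :
    ∫ x : Fin n → ℝ, max 0 ((Finset.univ.erase i).sup' hs fun j => ψ (x j))
        ∂(Measure.pi fun _ => μ) ≤
      ∫ x : Fin n → ℝ, Finset.univ.sup' hu (fun j => ψ (x j)) ∂(Measure.pi fun _ => μ) := by
  have hg : ∀ j : Fin n, Integrable (fun x : Fin n → ℝ => ψ (x j)) (Measure.pi fun _ => μ) :=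
    fun j => integrable_comp_eval (μ := fun _ : Fin n => μ) hψ
  have hA := integrable_sup' (Measure.pi fun _ : Fin n => μ) Finset.univ hu _ hg
  have hP := integrable_sup' (Measure.pi fun _ : Fin n => μ) _ hs _ hg
  obtain ⟨e, hi⟩ := integral_update μ i _ hA
  rw [e]
  have key : ∀ (x : Fin n → ℝ) (t : ℝ),
      (Finset.univ.sup' hu fun j => ψ (Function.update x i t j)) =
        max ((Finset.univ.erase i).sup' hs fun j => ψ (x j)) (ψ t) := by
    intro x t
    rw [← sup'_erase_update i hs ψ x t]
    apply le_antisymm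
    · refine Finset.sup'_le _ _ fun j _ => ?_
      by_cases hj : j = i
      · subst hj; simp
      · exact le_max_of_le_left (Finset.le_sup' (fun j => ψ (Function.update x i t j))
          (Finset.mem_erase.2 ⟨hj, Finset.mem_univ j⟩))
    · refine max_le (Finset.sup'_mono _ (Finset.erase_subset _ _) _) ?_
      have := Finset.le_sup' (fun j => ψ (Function.update x i t j)) (Finset.mem_univ i)
      simpa only [Function.update_self] using this
  refine integral_mono ((integrable_zero _ _ _).sup hP) hi fun x => ?_
  simp only [key]
  have hm : Integrable (fun t => max ((Finset.univ.erase i).sup' hs fun j => ψ (x j)) (ψ t)) μ :=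
    (integrable_const _).sup hψ
  refine max_le ?_ ?_
  · rw [← h0]
    exact integral_mono hψ hm fun t => le_max_right _ _
  · calc _ = ∫ t, ((Finset.univ.erase i).sup' hs fun j => ψ (x j)) ∂μ := by simp
      _ ≤ _ := integral_mono (integrable_const _) hm fun t => le_max_left _ _

lemma avg_step {n : ℕ} (v : Fin n → ℝ)
    (hu : (Finset.univ : Finset (Fin n)).Nonempty) (hs : ∀ i : Fin n, (Finset.univ.erase i).Nonempty) :
    ((n : ℝ) - 1) * max 0 (Finset.univ.sup' hu v) ≤
      ∑ i, max 0 ((Finset.univ.erase i).sup' (hs i) v) := by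
  obtain ⟨k, -, hk⟩ := Finset.exists_mem_eq_sup' hu v
  rw [hk]
  have hc : ((n : ℝ) - 1) = ((Finset.univ.erase k).card : ℝ) := by
    rw [Finset.card_erase_of_mem (Finset.mem_univ k), Finset.card_univ, Fintype.card_fin,
      Nat.cast_pred k.pos]
  rw [hc, ← nsmul_eq_mul, ← Finset.sum_const]
  refine (Finset.sum_le_sum fun i hi => ?_).trans
    (Finset.sum_le_sum_of_subset_of_nonneg (Finset.erase_subset k _) fun i _ _ => le_max_left _ _)
  exact max_le_max le_rfl (Finset.le_sup' v
    (Finset.mem_erase.2 ⟨(Finset.ne_of_mem_erase hi).symm, Finset.mem_univ k⟩))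

/-- Expected payments equal expected virtual surplus, for one bidder. -/
lemma pay_step {n : ℕ} (μ : Measure ℝ) [IsProbabilityMeasure μ] (ψ : ℝ → ℝ)
    (hexp : Integrable (fun x => x) μ) (hnn : ∀ᵐ x ∂μ, 0 ≤ x)
    (hψ : Integrable ψ μ)
    (hpay : ∀ m, 0 ≤ m → ∫ t in Ioi m, ψ t ∂μ = m * μ.real (Ioi m))
    (i : Fin n) (hs : (Finset.univ.erase i).Nonempty) :
    Integrable ({x : Fin n → ℝ | (Finset.univ.erase i).sup' hs x < x i}.indicator fun x => ψ (x i))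
      (Measure.pi fun _ => μ) ∧
    Integrable ({x : Fin n → ℝ | (Finset.univ.erase i).sup' hs x < x i}.indicator
      fun x => (Finset.univ.erase i).sup' hs x) (Measure.pi fun _ => μ) ∧
    ∫ x, {x : Fin n → ℝ | (Finset.univ.erase i).sup' hs x < x i}.indicator (fun x => ψ (x i)) x
      ∂(Measure.pi fun _ => μ) =
    ∫ x, {x : Fin n → ℝ | (Finset.univ.erase i).sup' hs x < x i}.indicator
      (fun x => (Finset.univ.erase i).sup' hs x) x ∂(Measure.pi fun _ => μ) := by
  have hS : MeasurableSet {x : Fin n → ℝ | (Finset.univ.erase i).sup' hs x < x i} :=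
    measurableSet_lt (measurable_sup'' _ hs) (measurable_pi_apply i)
  have h1 : Integrable (fun x : Fin n → ℝ => ψ (x i)) (Measure.pi fun _ => μ) :=
    integrable_comp_eval (μ := fun _ : Fin n => μ) hψ
  have h2 : Integrable (fun x : Fin n → ℝ => (Finset.univ.erase i).sup' hs x)
      (Measure.pi fun _ => μ) :=
    integrable_sup' (Measure.pi fun _ : Fin n => μ) _ hs (fun j x => x j)
      fun j => integrable_comp_eval (μ := fun _ : Fin n => μ) hexp
  refine ⟨h1.indicator hS, h2.indicator hS, ?_⟩
  rw [(integral_update μ i _ (h1.indicator hS)).1, (integral_update μ i _ (h2.indicator hS)).1]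
  have hae : ∀ᵐ x ∂(Measure.pi fun _ : Fin n => μ), ∀ j, 0 ≤ x j :=
    ae_all_iff.2 fun j => (measurePreserving_eval (fun _ : Fin n => μ) j).quasiMeasurePreserving.ae hnn
  refine integral_congr_ae ?_
  filter_upwards [hae] with x hx
  have hM : 0 ≤ (Finset.univ.erase i).sup' hs x := by
    obtain ⟨k, -, hk⟩ := Finset.exists_mem_eq_sup' hs x
    rw [hk]; exact hx k
  have e : ∀ t, (Finset.univ.erase i).sup' hs (Function.update x i t) =
      (Finset.univ.erase i).sup' hs x := fun t => sup'_erase_update i hs id x t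
  have e1 : (fun t => {x : Fin n → ℝ | (Finset.univ.erase i).sup' hs x < x i}.indicator
      (fun x => ψ (x i)) (Function.update x i t)) =
      (Ioi ((Finset.univ.erase i).sup' hs x)).indicator ψ := by
    ext t
    simp only [indicator, mem_ofPred_eq, e, mem_Ioi, Function.update_self]
  have e2 : (fun t => {x : Fin n → ℝ | (Finset.univ.erase i).sup' hs x < x i}.indicator
      (fun x => (Finset.univ.erase i).sup' hs x) (Function.update x i t)) =
      (Ioi ((Finset.univ.erase i).sup' hs x)).indicator
        (fun _ => (Finset.univ.erase i).sup' hs x) := by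
    ext t
    simp only [indicator, mem_ofPred_eq, e, mem_Ioi, Function.update_self]
  rw [e1, e2, integral_indicator measurableSet_Ioi, integral_indicator measurableSet_Ioi,
    hpay _ hM, setIntegral_const, smul_eq_mul, mul_comm]

lemma no_ties {n : ℕ} (μ : Measure ℝ) [IsProbabilityMeasure μ] [NullSingletonClass μ]
    (i : Fin n) (hs : (Finset.univ.erase i).Nonempty) :
    ∀ᵐ x ∂(Measure.pi fun _ : Fin n => μ), x i ≠ (Finset.univ.erase i).sup' hs x := by
  refine ae_update μ i _ ?_ fun x => ?_
  · exact (measurableSet_eq_fun (measurable_pi_apply i) (measurable_sup'' _ hs)).compl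
  · have e : ∀ t, (Finset.univ.erase i).sup' hs (Function.update x i t) =
      (Finset.univ.erase i).sup' hs x := fun t => sup'_erase_update i hs id x t
    simp [e, ae_iff]

lemma sum_unique {n : ℕ} (x : Fin n → ℝ) (hs : ∀ i : Fin n, (Finset.univ.erase i).Nonempty)
    (g : Fin n → (Fin n → ℝ) → ℝ) (k : Fin n)
    (hk : (Finset.univ.erase k).sup' (hs k) x < x k) :
    ∑ i, {x : Fin n → ℝ | (Finset.univ.erase i).sup' (hs i) x < x i}.indicator (g i) x
      = g k x := by
  rw [Finset.sum_eq_single k]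
  · rw [indicator_of_mem]; exact hk
  · intro i _ hi
    rw [indicator_of_notMem]
    intro h
    change (Finset.univ.erase i).sup' (hs i) x < x i at h
    have h1 := Finset.le_sup' x (Finset.mem_erase.2 ⟨hi, Finset.mem_univ i⟩)
    have h2 := Finset.le_sup' x (Finset.mem_erase.2 ⟨hi.symm, Finset.mem_univ k⟩)
    linarith
  · simp

lemma main_ineq (n : ℕ) (hn : 2 ≤ n) (μ : Measure ℝ) [IsProbabilityMeasure μ] [NullSingletonClass μ]
    (ψ : ℝ → ℝ)
    (hreg : StrictMonoOn ψ (Ici 0))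
    (hexp : Integrable (fun x => x) μ) (hnn : ∀ᵐ x ∂μ, 0 ≤ x)
    (hψ : Integrable ψ μ) (h0 : ∫ x, ψ x ∂μ = 0)
    (hpay : ∀ m, 0 ≤ m → ∫ t in Ioi m, ψ t ∂μ = m * μ.real (Ioi m))
    (hu : (Finset.univ : Finset (Fin n)).Nonempty) :
    ((1 : ℝ) - 1 / n) *
        (∫ x : Fin n → ℝ, max 0 (Finset.univ.sup' hu fun i => ψ (x i)) ∂(Measure.pi fun _ => μ))
      ≤ (∫ x : Fin n → ℝ, secondHighest hn x ∂(Measure.pi fun _ => μ)) := by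
  have hs : ∀ i : Fin n, (Finset.univ.erase i).Nonempty := fun i => by
    rw [← Finset.card_pos, Finset.card_erase_of_mem (Finset.mem_univ i),
      Finset.card_univ, Fintype.card_fin]
    omega
  have hg : ∀ j : Fin n, Integrable (fun x : Fin n → ℝ => ψ (x j)) (Measure.pi fun _ => μ) :=
    fun j => integrable_comp_eval (μ := fun _ : Fin n => μ) hψ
  have hx : ∀ j : Fin n, Integrable (fun x : Fin n → ℝ => x j) (Measure.pi fun _ => μ) :=
    fun j => integrable_comp_eval (μ := fun _ : Fin n => μ) hexp
  have hA := integrable_sup' (Measure.pi fun _ : Fin n => μ) Finset.univ hu _ hg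
  have hP := fun i => integrable_sup' (Measure.pi fun _ : Fin n => μ) _ (hs i) _ hg
  have hsec : Integrable (fun x : Fin n → ℝ => secondHighest hn x) (Measure.pi fun _ => μ) :=
    integrable_sup' (Measure.pi fun _ : Fin n => μ) Finset.univ hu
      (fun i x => min (x i) ((Finset.univ.erase i).sup' (hs i) x)) fun i =>
        (hx i).inf (integrable_sup' (Measure.pi fun _ : Fin n => μ) _ (hs i) _ hx)
  have hae : ∀ᵐ x ∂(Measure.pi fun _ : Fin n => μ), ∀ j, 0 ≤ x j :=
    ae_all_iff.2 fun j => (measurePreserving_eval (fun _ : Fin n => μ) j).quasiMeasurePreserving.ae hnn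
  have hties : ∀ᵐ x ∂(Measure.pi fun _ : Fin n => μ), ∀ i,
      x i ≠ (Finset.univ.erase i).sup' (hs i) x := ae_all_iff.2 fun i => no_ties μ i (hs i)
  have hp := fun i => pay_step μ ψ hexp hnn hψ hpay i (hs i)
  have c : ∫ x : Fin n → ℝ, Finset.univ.sup' hu (fun j => ψ (x j)) ∂(Measure.pi fun _ => μ) ≤
      ∫ x : Fin n → ℝ, secondHighest hn x ∂(Measure.pi fun _ => μ) := by
    calc _ ≤ ∫ x : Fin n → ℝ, ∑ i, {x : Fin n → ℝ | (Finset.univ.erase i).sup' (hs i) x < x i}.indicator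
          (fun x => ψ (x i)) x ∂(Measure.pi fun _ => μ) := by
          refine integral_mono_ae hA (integrable_finsetSum _ fun i _ => (hp i).1) ?_
          filter_upwards [hae, hties] with x hx hxt
          obtain ⟨k, -, hk⟩ := Finset.exists_mem_eq_sup' hu x
          have hk' : ∀ j, x j ≤ x k := fun j => hk ▸ Finset.le_sup' x (Finset.mem_univ j)
          rw [sum_unique x hs (fun i x => ψ (x i)) k
            (lt_of_le_of_ne (Finset.sup'_le _ _ fun j _ => hk' j) (hxt k).symm)]
          exact Finset.sup'_le _ _ fun j _ => hreg.monotoneOn (hx j) (hx k) (hk' j)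
      _ = ∫ x : Fin n → ℝ, ∑ i, {x : Fin n → ℝ | (Finset.univ.erase i).sup' (hs i) x < x i}.indicator
          (fun x => (Finset.univ.erase i).sup' (hs i) x) x ∂(Measure.pi fun _ => μ) := by
          rw [integral_finsetSum _ fun i _ => (hp i).1, integral_finsetSum _ fun i _ => (hp i).2.1]
          exact Finset.sum_congr rfl fun i _ => (hp i).2.2
      _ ≤ _ := by
          refine integral_mono_ae (integrable_finsetSum _ fun i _ => (hp i).2.1) hsec ?_
          filter_upwards [hae, hties] with x hx hxt
          obtain ⟨k, -, hk⟩ := Finset.exists_mem_eq_sup' hu x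
          have hk' : ∀ j, x j ≤ x k := fun j => hk ▸ Finset.le_sup' x (Finset.mem_univ j)
          have hlt := (lt_of_le_of_ne (Finset.sup'_le (hs k) _ fun j _ => hk' j) (hxt k).symm)
          rw [sum_unique x hs (fun i x => (Finset.univ.erase i).sup' (hs i) x) k hlt]
          have := Finset.le_sup' (fun i => min (x i) ((Finset.univ.erase i).sup' (hs i) x))
            (Finset.mem_univ k)
          simp only [min_eq_right hlt.le] at this
          exact this
  have a : ((n : ℝ) - 1) * ∫ x : Fin n → ℝ, max 0 (Finset.univ.sup' hu fun i => ψ (x i))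
        ∂(Measure.pi fun _ => μ) ≤
      n * ∫ x : Fin n → ℝ, secondHighest hn x ∂(Measure.pi fun _ => μ) := by
    have hPi : ∀ i, Integrable (fun x : Fin n → ℝ =>
        max 0 ((Finset.univ.erase i).sup' (hs i) fun j => ψ (x j))) (Measure.pi fun _ => μ) :=
      fun i => (integrable_zero _ _ _).sup (hP i)
    have hA0 : Integrable (fun x : Fin n → ℝ =>
        max 0 (Finset.univ.sup' hu fun j => ψ (x j))) (Measure.pi fun _ => μ) :=
      (integrable_zero _ _ _).sup hA
    rw [← integral_const_mul]
    calc _ ≤ ∫ x : Fin n → ℝ, ∑ i, max 0 ((Finset.univ.erase i).sup' (hs i) fun j => ψ (x j))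
          ∂(Measure.pi fun _ => μ) :=
          integral_mono (hA0.const_mul _) (integrable_finsetSum _ fun i _ => hPi i)
            fun x => avg_step (fun j => ψ (x j)) hu hs
      _ = ∑ i, ∫ x : Fin n → ℝ, max 0 ((Finset.univ.erase i).sup' (hs i) fun j => ψ (x j))
          ∂(Measure.pi fun _ => μ) := integral_finsetSum _ fun i _ => hPi i
      _ ≤ ∑ i : Fin n, ∫ x : Fin n → ℝ, secondHighest hn x ∂(Measure.pi fun _ => μ) :=
          Finset.sum_le_sum fun i _ => (bk_step μ ψ hψ h0 i hu (hs i)).trans c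
      _ = _ := by simp
  have hn0 : (0 : ℝ) < n := by exact_mod_cast (by omega : 0 < n)
  have e : (1 : ℝ) - 1 / n = (n - 1) / n := by field_simp
  rw [e, div_mul_eq_mul_div, div_le_iff₀ hn0]
  linarith

/-- **The Vickrey auction is a `(n-1)/n`-approximation of the Myerson auction** in the
symmetric regular case:
`E[second-highest of X₁,…,Xₙ] ≥ (1 - 1/n) E[max(0, maxᵢ ψ(Xᵢ))]`.  A key step is the
per-bidder payment monotonicity in the Myerson auction: with `rstar` the monopoly price
(root of `ψ`), `∫_{x ≥ rstar} (x f x - (1 - F x)) F^{n-1}(x) dx ≥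
∫_{x ≥ rstar} (x f x - (1 - F x)) Fⁿ(x) dx`. -/
theorem vickrey_approximates_myerson
    (n : ℕ) (hn : 2 ≤ n)
    (F f ψ : ℝ → ℝ)
    (hf_cont : Continuous f) (hf_pos : ∀ x, 0 ≤ x → 0 < f x)
    (hF : ∀ x, F x = ∫ t in (0:ℝ)..x, f t)
    (hψ : ∀ x, ψ x = x - (1 - F x) / f x)
    (hreg : StrictMonoOn ψ (Ici 0))
    (rstar : ℝ) (hrstar : 0 ≤ rstar) (hroot : ψ rstar = 0)
    (μ : Measure ℝ) (hμ : μ = valueMeasure f)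
    (hprob : IsProbabilityMeasure μ)
    (hexp : Integrable (fun x => x) μ) :
    ((1 : ℝ) - 1 / n) *
        (∫ x : Fin n → ℝ,
          max 0 (Finset.univ.sup' ⟨⟨0, by omega⟩, Finset.mem_univ _⟩ fun i => ψ (x i))
          ∂(Measure.pi fun _ => μ))
      ≤ (∫ x : Fin n → ℝ, secondHighest hn x ∂(Measure.pi fun _ => μ)) ∧
    (∫ x in Ici rstar, (x * f x - (1 - F x)) * F x ^ n)
      ≤ ∫ x in Ici rstar, (x * f x - (1 - F x)) * F x ^ (n - 1) := by
  
  obtain ⟨hnn, hna, hψi, hψm, h0, hpay, hint, hF01, hFc⟩ :=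
    one_dim F f ψ hf_cont hf_pos hF hψ μ hμ hprob hexp
  refine ⟨main_ineq n hn μ ψ hreg hexp hnn hψi h0 hpay _, ?_⟩
  have hint' : IntegrableOn (fun x => x * f x - (1 - F x)) (Ici rstar) :=
    ((integrableOn_Ici_iff_integrableOn_Ioi).2 hint).mono_set (Ici_subset_Ici.2 hrstar)
  have hpow : ∀ k : ℕ, IntegrableOn (fun x => (x * f x - (1 - F x)) * F x ^ k) (Ici rstar) := by
    intro k
    refine Integrable.mono hint' (by fun_prop) ?_
    filter_upwards [ae_restrict_mem measurableSet_Ici] with x hx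
    obtain ⟨h1, h2⟩ := hF01 x (hrstar.trans hx)
    rw [norm_mul]
    refine mul_le_of_le_one_right (norm_nonneg _) ?_
    rw [norm_pow, Real.norm_of_nonneg h1]
    exact pow_le_one₀ h1 h2
  refine setIntegral_mono_on (hpow n) (hpow (n - 1)) measurableSet_Ici fun x hx => ?_
  have hx0 : 0 ≤ x := hrstar.trans hx
  obtain ⟨h1, h2⟩ := hF01 x hx0
  refine mul_le_mul_of_nonneg_left (pow_le_pow_of_le_one h1 h2 (Nat.sub_le _ _)) ?_
  have h3 : 0 ≤ ψ x := hroot ▸ hreg.monotoneOn hrstar hx0 hx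
  have h4 := hf_pos x hx0
  have h5 : x * f x - (1 - F x) = ψ x * f x := by rw [hψ]; field_simp
  rw [h5]; positivity
end
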